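/- Let β⃗ be sub-critical and X ~ ERGM(β⃗) on 𝒢_n. Then: (i) Var(X_1 + ⋯ + X_M) = O(M) as n → ∞, i.e. there is C with Var(Σ_e X_e) ≤ CM for large n; (ii) for all edges i ≠ j, Cov(X_i, X_j) ≥ 0 (FKG inequality); (iii) there is a constant C > 0 such that for all sufficiently large n, Cov(X_i, X_j) ≤ C/n² whenever the edges i and j share no vertex, and Cov(X_i, X_j) ≤ C/n whenever the distinct edges i and j share a vertex. -/

import Mathlib

open Finset MeasureTheory Filter
open scoped ENNReal NNReal

namespace ERGM

/-- The set of edges of the complete graph on `Fin n`: non-diagonal unordered pairs. -/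
abbrev EdgeSet (n : ℕ) : Type := {p : Sym2 (Fin n) // ¬ p.IsDiag}

/-- A configuration (graph on `n` vertices): an assignment of `true/false` to each edge. -/
abbrev Config (n : ℕ) : Type := EdgeSet n → Bool

/-- The value of the configuration `x` on the (unordered) pair `{i,j}`; `false` for `i = j`. -/
noncomputable def edgeVal {n : ℕ} (x : Config n) (i j : Fin n) : Bool :=
  if h : (s(i, j) : Sym2 (Fin n)).IsDiag then false else x ⟨s(i, j), h⟩

/-- Real-valued indicator of presence of the edge `{i,j}` in `x`. -/
noncomputable def edgeInd {n : ℕ} (x : Config n) (i j : Fin n) : ℝ :=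
  if edgeVal x i j = true then 1 else 0

open scoped Classical in
/-- Subgraph counting number `N_G(x)`: the number of copies of `G` in `x` (times the
number of automorphisms), i.e. the sum over injective `ψ` of the product of edge
indicators (each edge indicator is idempotent, so counting ordered adjacent pairs
yields the same value as counting edges). -/
noncomputable def NG {n m : ℕ} (G : SimpleGraph (Fin m)) (x : Config n) : ℝ :=
  ∑ ψ : Fin m ↪ Fin n, ∏ a : Fin m, ∏ b : Fin m,
    if G.Adj a b then edgeInd x (ψ a) (ψ b) else 1

/-- The Hamiltonian `H(x) = Σ_i β_i N_{G_i}(x) / n^{|V_i|-2}`. -/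
noncomputable def Hamiltonian {n s : ℕ} (V : Fin s → ℕ)
    (G : ∀ i, SimpleGraph (Fin (V i))) (β : Fin s → ℝ) (x : Config n) : ℝ :=
  ∑ i, β i * NG (G i) x / (n : ℝ) ^ (V i - 2)

/-- The ERGM probability mass function `π(x) ∝ exp(H(x))`. -/
noncomputable def ergmProb {n s : ℕ} (V : Fin s → ℕ)
    (G : ∀ i, SimpleGraph (Fin (V i))) (β : Fin s → ℝ) (x : Config n) : ℝ :=
  Real.exp (Hamiltonian V G β x) / ∑ y : Config n, Real.exp (Hamiltonian V G β y)

/-- Expectation of `f` with respect to the mass function `w`. -/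
noncomputable def expect {n : ℕ} (w : Config n → ℝ) (f : Config n → ℝ) : ℝ :=
  ∑ x : Config n, w x * f x

open scoped Classical in
/-- Probability of the event `A` with respect to the mass function `w`. -/
noncomputable def prob {n : ℕ} (w : Config n → ℝ) (A : Config n → Prop) : ℝ :=
  ∑ x : Config n, if A x then w x else 0

/-- The number of edges `|E(G)|` of a finite graph. -/
noncomputable def numEdges {m : ℕ} (G : SimpleGraph (Fin m)) : ℕ := G.edgeSet.ncard

/-- `Ψ_β(p) = Σ_i 2 β_i |E_i| p^{|E_i|-1}`. -/
noncomputable def Psi {s : ℕ} (V : Fin s → ℕ) (G : ∀ i, SimpleGraph (Fin (V i)))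
    (β : Fin s → ℝ) (p : ℝ) : ℝ :=
  ∑ i, 2 * β i * (numEdges (G i) : ℝ) * p ^ (numEdges (G i) - 1)

/-- `Φ(u) = e^u / (1 + e^u)`. -/
noncomputable def Phi (u : ℝ) : ℝ := Real.exp u / (1 + Real.exp u)

/-- `φ_β(p) = Φ(Ψ_β(p))`. -/
noncomputable def phiFn {s : ℕ} (V : Fin s → ℕ) (G : ∀ i, SimpleGraph (Fin (V i)))
    (β : Fin s → ℝ) : ℝ → ℝ := fun p => Phi (Psi V G β p)

/-- `β` is sub-critical (high temperature) with fixed point `p`: `p` is the unique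
solution of `φ_β(p) = p` and it satisfies `φ_β'(p) < 1`. -/
def Subcritical {s : ℕ} (V : Fin s → ℕ) (G : ∀ i, SimpleGraph (Fin (V i)))
    (β : Fin s → ℝ) (p : ℝ) : Prop :=
  phiFn V G β p = p ∧ (∀ q : ℝ, phiFn V G β q = q → q = p) ∧
    deriv (phiFn V G β) p < 1

/-- The discrete derivative `∂_e H(x) = H(x_{e+}) - H(x_{e-})`. -/
noncomputable def dHam {n s : ℕ} (V : Fin s → ℕ) (G : ∀ i, SimpleGraph (Fin (V i)))
    (β : Fin s → ℝ) (e : EdgeSet n) (x : Config n) : ℝ :=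
  Hamiltonian V G β (Function.update x e true) - Hamiltonian V G β (Function.update x e false)

/-- Real-valued indicator `X_e` of presence of edge `e`. -/
noncomputable def edgeX {n : ℕ} (e : EdgeSet n) (x : Config n) : ℝ := if x e = true then 1 else 0

/-- Two edges of `K_n` share a vertex. -/
def ShareVertex {n : ℕ} (e f : EdgeSet n) : Prop := ∃ v : Fin n, v ∈ e.1 ∧ v ∈ f.1


/-- Variance of `f` under the mass function `w`. -/
noncomputable def variance {n : ℕ} (w : Config n → ℝ) (f : Config n → ℝ) : ℝ :=
  expect w (fun x => (f x - expect w f) ^ 2)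

/-- Covariance of `f` and `g` under the mass function `w`. -/
noncomputable def cov {n : ℕ} (w : Config n → ℝ) (f g : Config n → ℝ) : ℝ :=
  expect w (fun x => (f x - expect w f) * (g x - expect w g))

/-! ### Expectations and covariances under a mass function -/

section Expectation

variable {n : ℕ} {w : Config n → ℝ}

lemma expect_mono (hw : ∀ x, 0 ≤ w x) {f g : Config n → ℝ} (h : ∀ x, f x ≤ g x) :
    expect w f ≤ expect w g :=
  sum_le_sum fun x _ => mul_le_mul_of_nonneg_left (h x) (hw x)

lemma expect_add (f g : Config n → ℝ) :
    expect w (fun x => f x + g x) = expect w f + expect w g := by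
  simp [expect, mul_add, sum_add_distrib]

lemma expect_sub (f g : Config n → ℝ) :
    expect w (fun x => f x - g x) = expect w f - expect w g := by
  simp [expect, mul_sub, sum_sub_distrib]

lemma expect_const_mul (c : ℝ) (f : Config n → ℝ) :
    expect w (fun x => c * f x) = c * expect w f := by
  simp only [expect, mul_sum]
  exact sum_congr rfl fun x _ => by ring

lemma expect_sum {κ : Type*} (s : Finset κ) (f : κ → Config n → ℝ) :
    expect w (fun x => ∑ a ∈ s, f a x) = ∑ a ∈ s, expect w (f a) := by
  simp only [expect, mul_sum]
  exact sum_comm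

lemma expect_const (hw : ∑ x, w x = 1) (c : ℝ) : expect w (fun _ => c) = c := by
  rw [expect, ← sum_mul, hw, one_mul]

lemma cov_eq (hw : ∑ x, w x = 1) (f g : Config n → ℝ) :
    cov w f g = expect w (fun x => f x * g x) - expect w f * expect w g := by
  have h : (fun x => (f x - expect w f) * (g x - expect w g)) = fun x =>
      f x * g x - (expect w g * f x + (expect w f * g x + (-(expect w f * expect w g)))) := by
    funext x; ring
  rw [cov, h, expect_sub, expect_add, expect_add, expect_const_mul, expect_const_mul,
    expect_const hw]
  ring

lemma cov_comm (f g : Config n → ℝ) : cov w f g = cov w g f := by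
  simp only [cov, mul_comm]

lemma cov_eq_centered (hw : ∑ x, w x = 1) (f g : Config n → ℝ) :
    cov w f g = expect w (fun x => (f x - expect w f) * g x) := by
  have h : (fun x => (f x - expect w f) * g x) = fun x => f x * g x - expect w f * g x := by
    funext x; ring
  rw [cov_eq hw, h, expect_sub, expect_const_mul]

lemma cov_add (hw : ∑ x, w x = 1) (f g h : Config n → ℝ) :
    cov w f (fun x => g x + h x) = cov w f g + cov w f h := by
  simp only [cov_eq_centered hw, mul_add, expect_add]

lemma cov_sub (hw : ∑ x, w x = 1) (f g h : Config n → ℝ) :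
    cov w f (fun x => g x - h x) = cov w f g - cov w f h := by
  simp only [cov_eq_centered hw, mul_sub, expect_sub]

lemma cov_const_mul (hw : ∑ x, w x = 1) (c : ℝ) (f g : Config n → ℝ) :
    cov w f (fun x => c * g x) = c * cov w f g := by
  simp only [cov_eq_centered hw, ← expect_const_mul]
  congr 1; funext x; ring

lemma cov_sum (hw : ∑ x, w x = 1) {κ : Type*} (s : Finset κ) (f : Config n → ℝ)
    (g : κ → Config n → ℝ) :
    cov w f (fun x => ∑ a ∈ s, g a x) = ∑ a ∈ s, cov w f (g a) := by
  simp only [cov_eq_centered hw, mul_sum, expect_sum]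

lemma cov_const (hw : ∑ x, w x = 1) (f : Config n → ℝ) (c : ℝ) :
    cov w f (fun _ => c) = 0 := by
  rw [cov_eq hw, expect_const hw]
  have : (fun x => f x * c) = fun x => c * f x := by funext x; ring
  rw [this, expect_const_mul]
  ring

end Expectation

/-! ### Edge monomials and polynomial Hamiltonians -/

section Polynomial

variable {n : ℕ}

lemma edgeX_nonneg (e : EdgeSet n) (x : Config n) : 0 ≤ edgeX e x := by
  unfold edgeX; split_ifs <;> norm_num

lemma edgeX_le_one (e : EdgeSet n) (x : Config n) : edgeX e x ≤ 1 := by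
  unfold edgeX; split_ifs <;> norm_num

lemma edgeX_mono (e : EdgeSet n) : Monotone (edgeX e) := by
  intro x y h
  have := h e
  unfold edgeX
  by_cases hx : x e = true
  · have : y e = true := by rw [hx] at this; exact top_le_iff.mp this
    simp [hx, this]
  · rw [if_neg hx]
    split_ifs <;> norm_num

lemma edgeX_update_self (e : EdgeSet n) (x : Config n) (b : Bool) :
    edgeX e (Function.update x e b) = if b = true then 1 else 0 := by
  simp [edgeX]

lemma edgeX_update_of_ne {e g : EdgeSet n} (h : g ≠ e) (x : Config n) (b : Bool) :
    edgeX g (Function.update x e b) = edgeX g x := by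
  simp [edgeX, Function.update_of_ne h]

/-- The monomial `∏ g ∈ A, x_g`. -/
noncomputable def mon (A : Finset (EdgeSet n)) (x : Config n) : ℝ := ∏ g ∈ A, edgeX g x

lemma mon_nonneg (A : Finset (EdgeSet n)) (x : Config n) : 0 ≤ mon A x :=
  prod_nonneg fun g _ => edgeX_nonneg g x

lemma mon_le_one (A : Finset (EdgeSet n)) (x : Config n) : mon A x ≤ 1 :=
  prod_le_one (fun g _ => edgeX_nonneg g x) fun g _ => edgeX_le_one g x

lemma mon_mono (A : Finset (EdgeSet n)) : Monotone (mon A) := fun _ _ h =>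
  prod_le_prod (fun g _ => edgeX_nonneg g _) fun g _ => edgeX_mono g h

lemma mon_eq_ite (A : Finset (EdgeSet n)) (x : Config n) :
    mon A x = if ∀ g ∈ A, x g = true then 1 else 0 := by
  unfold mon edgeX
  exact prod_ite_zero ..|>.trans (by simp)

lemma mon_update_of_notMem {A : Finset (EdgeSet n)} {e : EdgeSet n} (h : e ∉ A)
    (x : Config n) (b : Bool) : mon A (Function.update x e b) = mon A x :=
  prod_congr rfl fun _ hg => edgeX_update_of_ne (ne_of_mem_of_not_mem hg h) x b

lemma mon_eq_mul_erase {A : Finset (EdgeSet n)} {e : EdgeSet n} (h : e ∈ A) (x : Config n) :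
    mon A x = edgeX e x * mon (A.erase e) x :=
  (mul_prod_erase A (fun g => edgeX g x) h).symm

lemma mon_supermodular (A : Finset (EdgeSet n)) (x y : Config n) :
    mon A x + mon A y ≤ mon A (x ⊓ y) + mon A (x ⊔ y) := by
  by_cases hx : ∀ g ∈ A, x g = true
  · have hs : mon A (x ⊔ y) = 1 := by
      rw [mon_eq_ite, if_pos]; intro g hg; simp [hx g hg]
    have hi : mon A (x ⊓ y) = mon A y := by
      simp only [mon_eq_ite]
      congr 1
      refine propext (forall₂_congr fun g hg => ?_)
      simp [hx g hg]
    have := mon_le_one A x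
    linarith
  · have h0 : mon A x = 0 := by rw [mon_eq_ite, if_neg hx]
    have := mon_mono A (show y ≤ x ⊔ y from le_sup_right)
    have := mon_nonneg A (x ⊓ y)
    linarith

variable {ι : Type*} [Fintype ι] (W : ι → ℝ) (A : ι → Finset (EdgeSet n))

/-- The polynomial `∑ α, W α * ∏ g ∈ A α, x_g`. -/
noncomputable def energy (x : Config n) : ℝ := ∑ α, W α * mon (A α) x

/-- The Gibbs mass function of a polynomial Hamiltonian. -/
noncomputable def gibbs (x : Config n) : ℝ :=
  Real.exp (energy W A x) / ∑ y : Config n, Real.exp (energy W A y)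

/-- The discrete derivative of `energy W A` at the edge `e`. -/
noncomputable def field (e : EdgeSet n) (x : Config n) : ℝ :=
  ∑ α with e ∈ A α, W α * mon ((A α).erase e) x

lemma energy_update_sub (e : EdgeSet n) (x : Config n) :
    energy W A (Function.update x e true) - energy W A (Function.update x e false) =
      field W A e x := by
  unfold energy field
  rw [← sum_sub_distrib, sum_filter]
  refine sum_congr rfl fun α _ => ?_
  split_ifs with h
  · rw [mon_eq_mul_erase h, mon_eq_mul_erase h, edgeX_update_self, edgeX_update_self,
      mon_update_of_notMem (notMem_erase e _)]
    simp
  · rw [mon_update_of_notMem h, mon_update_of_notMem h, sub_self]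

lemma field_update (e : EdgeSet n) (x : Config n) (b : Bool) :
    field W A e (Function.update x e b) = field W A e x :=
  sum_congr rfl fun α _ => by rw [mon_update_of_notMem (notMem_erase e _)]

variable {W} in
lemma field_mono (hW : ∀ α, 0 ≤ W α) (e : EdgeSet n) : Monotone (field W A e) := fun _ _ h =>
  sum_le_sum fun α _ => mul_le_mul_of_nonneg_left (mon_mono _ h) (hW α)

variable {W} in
lemma field_nonneg (hW : ∀ α, 0 ≤ W α) (e : EdgeSet n) (x : Config n) : 0 ≤ field W A e x :=
  sum_nonneg fun α _ => mul_nonneg (hW α) (mon_nonneg _ x)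

end Polynomial

/-! ### Resampling an edge -/

section Resample

variable {n : ℕ}

lemma Phi_eq_sigmoid : Phi = Real.sigmoid := by
  funext u
  rw [Phi, Real.sigmoid_def, Real.exp_neg]
  have := Real.exp_pos u
  field_simp
  ring

/-- Resample the edge `e`, switching it on with probability `c x`. -/
noncomputable def resample (c : Config n → ℝ) (e : EdgeSet n) (f : Config n → ℝ)
    (x : Config n) : ℝ :=
  c x * f (Function.update x e true) + (1 - c x) * f (Function.update x e false)

lemma sum_config_eq_half (e : EdgeSet n) (F : Config n → ℝ) :
    ∑ x, F x = (1 / 2) * ∑ x,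
      (F (Function.update x e true) + F (Function.update x e false)) := by
  have hinv : Function.Involutive fun x : Config n => Function.update x e (!x e) := by
    intro x
    simp
  have h1 : ∑ x, F (Function.update x e (!x e)) = ∑ x, F x :=
    Equiv.sum_comp (hinv.toPerm _) F
  have h2 : ∀ x : Config n, F (Function.update x e true) + F (Function.update x e false) =
      F x + F (Function.update x e (!x e)) := by
    intro x
    cases hx : x e
    · have : Function.update x e false = x := by rw [← hx, Function.update_eq_self]
      simp [this, add_comm]
    · have : Function.update x e true = x := by rw [← hx, Function.update_eq_self]
      simp [this]
  simp_rw [h2, sum_add_distrib, h1]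
  ring

/-- A mass function `w` on configurations satisfying the FKG inequality, whose conditional
probability of having the edge `e` present is `Phi (u e x)`, where `u` is increasing. -/
structure IsFerromagnetic (w : Config n → ℝ) (u : EdgeSet n → Config n → ℝ) : Prop where
  nonneg : ∀ x, 0 ≤ w x
  sum_eq_one : ∑ x, w x = 1
  cov_nonneg : ∀ f g, Monotone f → Monotone g → 0 ≤ cov w f g
  expect_resample : ∀ e f, expect w (resample (fun x => Phi (u e x)) e f) = expect w f
  field_mono : ∀ e, Monotone (u e)
  field_nonneg : ∀ e x, 0 ≤ u e x
  field_update : ∀ e x b, u e (Function.update x e b) = u e x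

variable {ι : Type*} [Fintype ι] (W : ι → ℝ) (A : ι → Finset (EdgeSet n))

lemma sum_exp_energy_pos : 0 < ∑ y : Config n, Real.exp (energy W A y) :=
  sum_pos (fun _ _ => Real.exp_pos _) univ_nonempty

lemma gibbs_sum : ∑ x, gibbs W A x = 1 := by
  simp only [gibbs, ← sum_div]
  exact div_self (sum_exp_energy_pos W A).ne'

lemma gibbs_nonneg (x : Config n) : 0 ≤ gibbs W A x :=
  div_nonneg (Real.exp_pos _).le (sum_exp_energy_pos W A).le

lemma gibbs_expect_resample (e : EdgeSet n) (f : Config n → ℝ) :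
    expect (gibbs W A) (resample (fun x => Phi (field W A e x)) e f) =
      expect (gibbs W A) f := by
  unfold expect
  rw [sum_config_eq_half e, sum_config_eq_half e (fun x => gibbs W A x * f x)]
  congr 1
  refine sum_congr rfl fun x _ => ?_
  simp only [resample, field_update, Function.update_idem]
  have h : gibbs W A (Function.update x e true) =
      Real.exp (field W A e x) * gibbs W A (Function.update x e false) := by
    rw [gibbs, gibbs, ← energy_update_sub, Real.exp_sub]
    field_simp
  rw [h, Phi]
  have := Real.exp_pos (field W A e x)
  field_simp
  ring

variable {W} in
lemma gibbs_cov_nonneg (hW : ∀ α, 0 ≤ W α) {f g : Config n → ℝ} (hf : Monotone f)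
    (hg : Monotone g) : 0 ≤ cov (gibbs W A) f g := by
  have key : ∀ x y : Config n, gibbs W A x * gibbs W A y ≤
      gibbs W A (x ⊓ y) * gibbs W A (x ⊔ y) := by
    intro x y
    simp only [gibbs, div_mul_div_comm, ← Real.exp_add]
    refine div_le_div_of_nonneg_right (Real.exp_le_exp.mpr ?_)
      (mul_self_nonneg _)
    simp only [energy, ← sum_add_distrib, ← mul_add]
    exact sum_le_sum fun α _ => mul_le_mul_of_nonneg_left (mon_supermodular _ x y) (hW α)
  have shift : ∀ h : Config n → ℝ, cov (gibbs W A) f h =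
      cov (gibbs W A) f (fun x => h x - h ⊥) := fun h => by
    rw [cov_sub (gibbs_sum W A), cov_const (gibbs_sum W A), sub_zero]
  rw [shift g, cov_comm]
  have shift' : ∀ h : Config n → ℝ, cov (gibbs W A) h f =
      cov (gibbs W A) h (fun x => f x - f ⊥) := fun h => by
    rw [cov_sub (gibbs_sum W A), cov_const (gibbs_sum W A), sub_zero]
  rw [shift', cov_eq (gibbs_sum W A), sub_nonneg]
  have := fkg (μ := gibbs W A) (f := fun x => g x - g ⊥) (g := fun x => f x - f ⊥)
    (fun x => gibbs_nonneg W A x)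
    (fun x => sub_nonneg.mpr (hg bot_le)) (fun x => sub_nonneg.mpr (hf bot_le))
    (fun x y h => sub_le_sub_right (hg h) _) (fun x y h => sub_le_sub_right (hf h) _) key
  rwa [gibbs_sum, one_mul] at this

variable {W} in
lemma gibbs_isFerromagnetic (hW : ∀ α, 0 ≤ W α) :
    IsFerromagnetic (gibbs W A) (field W A) where
  nonneg := gibbs_nonneg W A
  sum_eq_one := gibbs_sum W A
  cov_nonneg _ _ hf hg := gibbs_cov_nonneg A hW hf hg
  expect_resample := gibbs_expect_resample W A
  field_mono := field_mono A hW
  field_nonneg := field_nonneg A hW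
  field_update := field_update W A

end Resample

/-! ### Covariances with the edge count -/

section EdgeCount

variable {n : ℕ}

/-- The number of edges of a configuration. -/
noncomputable def edgeCount (x : Config n) : ℝ := ∑ e : EdgeSet n, edgeX e x

lemma edgeCount_mono : Monotone (edgeCount (n := n)) := fun _ _ h =>
  sum_le_sum fun e _ => edgeX_mono e h

lemma edgeCount_nonneg (x : Config n) : 0 ≤ edgeCount x :=
  sum_nonneg fun e _ => edgeX_nonneg e x

lemma edgeCount_le (x : Config n) : edgeCount x ≤ Fintype.card (EdgeSet n) := by
  refine (sum_le_sum fun e _ => edgeX_le_one e x).trans ?_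
  simp

lemma edgeCount_update (e : EdgeSet n) (x : Config n) :
    edgeCount (Function.update x e true) = edgeCount (Function.update x e false) + 1 := by
  have h : ∀ b, edgeCount (Function.update x e b) =
      (if b = true then 1 else 0) + ∑ g ∈ univ.erase e, edgeX g x := by
    intro b
    rw [edgeCount, ← add_sum_erase _ _ (mem_univ e), edgeX_update_self]
    congr 1
    exact sum_congr rfl fun g hg => edgeX_update_of_ne (ne_of_mem_erase hg) x b
  rw [h, h]
  simp
  ring

lemma Phi_nonneg (t : ℝ) : 0 ≤ Phi t := by
  rw [Phi_eq_sigmoid]; exact Real.sigmoid_nonneg t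

lemma Phi_le_one (t : ℝ) : Phi t ≤ 1 := by
  rw [Phi_eq_sigmoid]; exact Real.sigmoid_le_one t

lemma Phi_monotone : Monotone Phi := by
  rw [Phi_eq_sigmoid]; exact Real.sigmoid_monotone

lemma half_le_Phi {t : ℝ} (ht : 0 ≤ t) : 1 / 2 ≤ Phi t := by
  have h : Phi 0 = 1 / 2 := by rw [Phi_eq_sigmoid, Real.sigmoid_zero]; norm_num
  exact h ▸ Phi_monotone ht

/-- Switch on all the edges of `B`. -/
def raise (B : Finset (EdgeSet n)) (x : Config n) : Config n := fun g => x g || decide (g ∈ B)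

lemma raise_empty (x : Config n) : raise ∅ x = x := by
  funext g; simp [raise]

lemma raise_update (B : Finset (EdgeSet n)) (e : EdgeSet n) (x : Config n) :
    raise B (Function.update x e true) = raise (insert e B) x := by
  funext g
  by_cases h : g = e
  · subst h; simp [raise]
  · simp [raise, h]

lemma raise_mono (B : Finset (EdgeSet n)) : Monotone (raise B) := by
  intro x y h g
  exact sup_le_sup_right (h g) _

lemma list_prod_map_mem_Icc {κ : Type*} {q : ℝ} (J : List κ) (v : κ → ℝ)
    (h0 : ∀ p ∈ J, 0 ≤ v p) (hq : ∀ p ∈ J, v p ≤ q) :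
    (J.map v).prod ∈ Set.Icc 0 (q ^ J.length) := by
  induction J with
  | nil => simp
  | cons a J ih =>
    have h := ih (fun p hp => h0 p (List.mem_cons_of_mem _ hp))
      fun p hp => hq p (List.mem_cons_of_mem _ hp)
    have ha := h0 a List.mem_cons_self
    have ha' := hq a List.mem_cons_self
    simp only [List.map_cons, List.prod_cons, List.length_cons, pow_succ']
    exact ⟨mul_nonneg ha h.1, mul_le_mul ha' h.2 h.1 (ha.trans ha')⟩

lemma abs_list_prod_sub_le {κ : Type*} (J : List κ) (h v : κ → ℝ)
    (hh : ∀ p, h p ∈ Set.Icc 0 1) (hv : ∀ p, v p ∈ Set.Icc 0 1) :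
    |(J.map h).prod - (J.map v).prod| ≤ (J.map fun p => |h p - v p|).sum := by
  induction J with
  | nil => simp
  | cons a J ih =>
    simp only [List.map_cons, List.prod_cons, List.sum_cons]
    have hJ := list_prod_map_mem_Icc (q := 1) J h (fun p _ => (hh p).1) fun p _ => (hh p).2
    rw [one_pow] at hJ
    have e : h a * (J.map h).prod - v a * (J.map v).prod =
        (h a - v a) * (J.map h).prod + v a * ((J.map h).prod - (J.map v).prod) := by ring
    rw [e]
    refine (abs_add_le _ _).trans (add_le_add ?_ ?_)
    · rw [abs_mul, abs_of_nonneg hJ.1]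
      exact mul_le_of_le_one_right (abs_nonneg _) hJ.2
    · rw [abs_mul, abs_of_nonneg (hv a).1]
      exact (mul_le_of_le_one_left (abs_nonneg _) (hv a).2).trans ih

lemma list_prod_map_mono {κ : Type*} (J : List κ) (v : κ → Config n → ℝ)
    (hv : ∀ p ∈ J, Monotone (v p)) (h0 : ∀ p ∈ J, ∀ x, 0 ≤ v p x) :
    Monotone fun x => (J.map fun p => v p x).prod := by
  induction J with
  | nil => intro x y _; simp
  | cons a J ih =>
    simp only [List.map_cons, List.prod_cons]
    exact (hv a List.mem_cons_self).mul
      (ih (fun p hp => hv p (List.mem_cons_of_mem _ hp))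
        fun p hp => h0 p (List.mem_cons_of_mem _ hp))
      (fun x => h0 a List.mem_cons_self x)
      fun x => List.prod_nonneg fun a ha => by
        obtain ⟨p, hp, rfl⟩ := List.mem_map.mp ha
        exact h0 p (List.mem_cons_of_mem _ hp) x

namespace IsFerromagnetic

variable {w : Config n → ℝ} {u : EdgeSet n → Config n → ℝ} (hw : IsFerromagnetic w u)
include hw

lemma cov_edgeCount_le {f g : Config n → ℝ} (h : Monotone fun x => g x - f x) :
    cov w edgeCount f ≤ cov w edgeCount g := by
  have := hw.cov_nonneg _ _ edgeCount_mono h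
  rw [cov_sub hw.sum_eq_one] at this
  linarith

lemma cov_edgeCount_le_add (f g : Config n → ℝ) :
    cov w edgeCount f ≤ cov w edgeCount g +
      Fintype.card (EdgeSet n) * expect w (fun x => |f x - g x|) := by
  have h : cov w edgeCount (fun x => f x - g x) ≤
      Fintype.card (EdgeSet n) * expect w (fun x => |f x - g x|) := by
    rw [cov_eq_centered hw.sum_eq_one, ← expect_const_mul]
    refine expect_mono hw.nonneg fun x => ?_
    refine (le_abs_self _).trans ?_
    rw [abs_mul]
    refine mul_le_mul_of_nonneg_right ?_ (abs_nonneg _)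
    have h0 : 0 ≤ expect w edgeCount := by
      have := expect_mono hw.nonneg (f := fun _ => 0) edgeCount_nonneg
      rwa [expect_const hw.sum_eq_one] at this
    have h1 : expect w edgeCount ≤ Fintype.card (EdgeSet n) := by
      have := expect_mono hw.nonneg (g := fun _ => (Fintype.card (EdgeSet n) : ℝ)) edgeCount_le
      rwa [expect_const hw.sum_eq_one] at this
    rw [abs_le]
    have := edgeCount_nonneg x
    have := edgeCount_le x
    constructor <;> linarith
  rw [cov_sub hw.sum_eq_one] at h
  linarith

lemma cov_edgeCount_le_resample (e : EdgeSet n) {f : Config n → ℝ} (h0 : ∀ x, 0 ≤ f x)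
    (h1 : ∀ x, f x ≤ 1) :
    cov w edgeCount f ≤ cov w edgeCount (resample (fun x => Phi (u e x)) e f) + 1 := by
  set K := resample (fun x => Phi (u e x)) e f with hK
  rw [cov_eq hw.sum_eq_one, cov_eq hw.sum_eq_one, hK, hw.expect_resample, ← hK]
  suffices h : expect w (fun x => edgeCount x * f x) ≤
      expect w (fun x => edgeCount x * K x) + 1 by linarith
  rw [← hw.expect_resample e, ← hw.expect_resample e (fun x => edgeCount x * K x),
    ← expect_const hw.sum_eq_one 1, ← expect_add]
  refine expect_mono hw.nonneg fun x => ?_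
  simp only [hK, resample, hw.field_update, Function.update_idem, edgeCount_update]
  have a0 := h0 (Function.update x e true)
  have a1 := h1 (Function.update x e true)
  have b0 := h0 (Function.update x e false)
  have c0 := Phi_nonneg (u e x)
  have c1 := Phi_le_one (u e x)
  set c := Phi (u e x)
  set s := edgeCount (Function.update x e false)
  set a := f (Function.update x e true)
  set b := f (Function.update x e false)
  have h2 : c * (1 - c) * (a - b) ≤ 1 := by
    have : c * (1 - c) ≤ 1 := by nlinarith
    have h3 : 0 ≤ c * (1 - c) := mul_nonneg c0 (by linarith)
    calc c * (1 - c) * (a - b) ≤ c * (1 - c) * 1 :=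
          mul_le_mul_of_nonneg_left (by linarith) h3
      _ ≤ 1 := by linarith
  nlinarith

lemma expect_update_true_le (e : EdgeSet n) {f : Config n → ℝ} (h0 : ∀ x, 0 ≤ f x) :
    expect w (fun x => f (Function.update x e true)) ≤ 2 * expect w f := by
  rw [← hw.expect_resample e f, ← expect_const_mul]
  refine expect_mono hw.nonneg fun x => ?_
  have h1 := half_le_Phi (hw.field_nonneg e x)
  have h2 := Phi_le_one (u e x)
  have h3 := h0 (Function.update x e true)
  have h4 := h0 (Function.update x e false)
  unfold resample
  nlinarith [mul_nonneg (sub_nonneg.mpr h2) h4, mul_nonneg (sub_nonneg.mpr h1) h3]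

lemma expect_raise_le (B : Finset (EdgeSet n)) {f : Config n → ℝ} (h0 : ∀ x, 0 ≤ f x) :
    expect w (fun x => f (raise B x)) ≤ 2 ^ B.card * expect w f := by
  induction B using Finset.induction_on with
  | empty => simp [raise_empty]
  | insert g B hg ih =>
    simp only [← raise_update]
    refine (hw.expect_update_true_le g (f := fun x => f (raise B x)) fun x => h0 _).trans ?_
    rw [card_insert_of_notMem hg, pow_succ]
    linarith

/-- Resampling the edges of a monomial one after the other replaces every edge variable by a
conditional probability. -/
lemma exists_cov_mon_mul_le (B : Finset (EdgeSet n)) :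
    ∀ (d : ℕ) (J : List (EdgeSet n × Finset (EdgeSet n))), (∀ p ∈ J, p.2.card ≤ d) →
    ∃ J' : List (EdgeSet n × Finset (EdgeSet n)), J'.length = J.length + B.card ∧
      (∀ p ∈ J', p.2.card ≤ d + B.card) ∧
      cov w edgeCount (fun x => mon B x * (J.map fun p => Phi (u p.1 (raise p.2 x))).prod) ≤
        B.card + cov w edgeCount (fun x => (J'.map fun p => Phi (u p.1 (raise p.2 x))).prod) := by
  induction B using Finset.induction_on with
  | empty => exact fun d J hJ => ⟨J, by simp, by simpa using hJ, by simp [mon]⟩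
  | insert g B hg ih =>
    intro d J hJ
    obtain ⟨J', hlen, hcard, hle⟩ := ih (d + 1) ((g, ∅) :: J.map fun p => (p.1, insert g p.2)) (by
      intro p hp
      rcases List.mem_cons.mp hp with rfl | hp
      · simp
      · obtain ⟨r, hr, rfl⟩ := List.mem_map.mp hp
        exact (card_insert_le _ _).trans (Nat.add_le_add_right (hJ r hr) 1))
    rw [card_insert_of_notMem hg]
    refine ⟨J', by simp only [List.length_cons, List.length_map] at hlen; omega,
      fun p hp => (hcard p hp).trans (by omega), ?_⟩
    have hJ01 : ∀ x : Config n, (J.map fun p => Phi (u p.1 (raise p.2 x))).prod ∈ Set.Icc 0 1 := by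
      intro x
      have := list_prod_map_mem_Icc (q := 1) J (fun p => Phi (u p.1 (raise p.2 x)))
        (fun _ _ => Phi_nonneg _) fun _ _ => Phi_le_one _
      rwa [one_pow] at this
    refine (hw.cov_edgeCount_le_resample g
      (fun x => mul_nonneg (mon_nonneg _ x) (hJ01 x).1)
      (fun x => mul_le_one₀ (mon_le_one _ x) (hJ01 x).1 (hJ01 x).2)).trans ?_
    have hres : resample (fun x => Phi (u g x)) g (fun x => mon (insert g B) x *
        (J.map fun p => Phi (u p.1 (raise p.2 x))).prod) = fun x => mon B x *
        (((g, ∅) :: J.map fun p => (p.1, insert g p.2)).map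
          fun p => Phi (u p.1 (raise p.2 x))).prod := by
      funext x
      have hm : ∀ b, mon (insert g B) (Function.update x g b) =
          (if b = true then 1 else 0) * mon B x := by
        intro b
        rw [mon_eq_mul_erase (mem_insert_self g B), erase_insert hg, edgeX_update_self,
          mon_update_of_notMem hg]
      simp only [resample, hm, raise_update, List.map_cons, List.map_map, List.prod_cons,
        raise_empty, Function.comp_def]
      simp
      ring
    rw [hres]
    push_cast
    linarith

lemma cov_edgeCount_mul_le {f g : Config n → ℝ} {a b : ℝ} (hf : Monotone f) (hg : Monotone g)
    (hfa : ∀ x, f x ≤ a) (hgb : ∀ x, g x ≤ b) :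
    cov w edgeCount (fun x => f x * g x) ≤
      b * cov w edgeCount f + a * cov w edgeCount g := by
  rw [← cov_const_mul hw.sum_eq_one, ← cov_const_mul hw.sum_eq_one, ← cov_add hw.sum_eq_one]
  refine hw.cov_edgeCount_le fun x y h => ?_
  have h1 := hf h
  have h2 := hg h
  have h3 := hfa x
  have h4 := hgb y
  nlinarith [mul_nonneg (sub_nonneg.mpr h1) (sub_nonneg.mpr h4),
    mul_nonneg (sub_nonneg.mpr h2) (sub_nonneg.mpr h3)]

lemma cov_edgeCount_list_prod_le {κ : Type*} {q c : ℝ} (hq : 0 ≤ q) (J : List κ)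
    (v : κ → Config n → ℝ) (hv : ∀ p ∈ J, Monotone (v p)) (h0 : ∀ p ∈ J, ∀ x, 0 ≤ v p x)
    (h1 : ∀ p ∈ J, ∀ x, v p x ≤ q) (hc : ∀ p ∈ J, cov w edgeCount (v p) ≤ c) :
    cov w edgeCount (fun x => (J.map fun p => v p x).prod) ≤
      J.length * q ^ (J.length - 1) * c := by
  induction J with
  | nil => simp [cov_const hw.sum_eq_one]
  | cons a J ih =>
    have hv' : ∀ p ∈ J, Monotone (v p) := fun p hp => hv p (List.mem_cons_of_mem _ hp)
    have h0' : ∀ p ∈ J, ∀ x, 0 ≤ v p x := fun p hp => h0 p (List.mem_cons_of_mem _ hp)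
    have h1' : ∀ p ∈ J, ∀ x, v p x ≤ q := fun p hp => h1 p (List.mem_cons_of_mem _ hp)
    have hi := ih hv' h0' h1' fun p hp => hc p (List.mem_cons_of_mem _ hp)
    simp only [List.map_cons, List.prod_cons, List.length_cons]
    have hm := hw.cov_edgeCount_mul_le (hv a List.mem_cons_self) (list_prod_map_mono J v hv' h0')
      (h1 a List.mem_cons_self)
      (fun x => (list_prod_map_mem_Icc J (fun p => v p x) (fun p hp => h0' p hp x)
        fun p hp => h1' p hp x).2)
    refine hm.trans ?_
    have hca := mul_le_mul_of_nonneg_left (hc a List.mem_cons_self) (pow_nonneg hq J.length)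
    have hci := mul_le_mul_of_nonneg_left hi hq
    have hpow : q * (J.length * q ^ (J.length - 1) * c) = J.length * q ^ J.length * c := by
      rcases Nat.eq_zero_or_pos J.length with h | h
      · simp [h]
      · obtain ⟨k, hk⟩ := Nat.exists_eq_succ_of_ne_zero h.ne'
        rw [hk, Nat.succ_sub_one, pow_succ]
        ring
    rw [Nat.add_sub_cancel]
    push_cast
    linarith

lemma cov_edgeCount_mon_le_sum (B : Finset (EdgeSet n)) {a : ℝ}
    (ha : ∀ g, cov w edgeCount (edgeX g) ≤ a) :
    cov w edgeCount (mon B) ≤ B.card * a := by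
  have h := hw.cov_edgeCount_list_prod_le zero_le_one B.toList (fun g => edgeX g)
    (fun g _ => edgeX_mono g) (fun g _ => edgeX_nonneg g) (fun g _ => edgeX_le_one g)
    fun g _ => ha g
  simp only [length_toList, one_pow, mul_one, prod_map_toList] at h
  exact h

end IsFerromagnetic

end EdgeCount

/-! ### Contraction of the covariances with the edge count -/

section Contraction

variable {n : ℕ}

/-- The indicator of leaving the interval `[l, r]`. -/
noncomputable def outside (l r t : ℝ) : ℝ := if l ≤ t ∧ t ≤ r then 0 else 1

/-- Truncation of `t` to the interval `[l, r]`. -/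
noncomputable def clamp (l r t : ℝ) : ℝ := max l (min r t)

lemma outside_nonneg (l r t : ℝ) : 0 ≤ outside l r t := by
  unfold outside; split_ifs <;> norm_num

lemma clamp_of_mem {l r t : ℝ} (h : l ≤ t ∧ t ≤ r) : clamp l r t = t := by
  rw [clamp, min_eq_right h.2, max_eq_right h.1]

lemma clamp_mono (l r : ℝ) : Monotone (clamp l r) := fun _ _ h =>
  max_le_max le_rfl (min_le_min le_rfl h)

lemma le_clamp (l r t : ℝ) : l ≤ clamp l r t := le_max_left _ _

lemma clamp_le {l r : ℝ} (h : l ≤ r) (t : ℝ) : clamp l r t ≤ r := max_le h (min_le_left _ _)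

lemma abs_Phi_sub_clamp_le (l r t : ℝ) : |Phi t - Phi (clamp l r t)| ≤ outside l r t := by
  unfold outside
  split_ifs with h
  · rw [clamp_of_mem h]; simp
  · have := Phi_nonneg t
    have := Phi_le_one t
    have := Phi_nonneg (clamp l r t)
    have := Phi_le_one (clamp l r t)
    rw [abs_le]; constructor <;> linarith

lemma abs_sub_clamp_le {l r t K : ℝ} (hlr : l ≤ r) (hl : |l| ≤ K) (hr : |r| ≤ K) (ht0 : 0 ≤ t)
    (ht : t ≤ K) : |t - clamp l r t| ≤ 2 * K * outside l r t := by
  unfold outside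
  split_ifs with h
  · rw [clamp_of_mem h]; simp
  · have := le_clamp l r t
    have := clamp_le hlr t
    rw [abs_le] at *
    constructor <;> linarith

namespace IsFerromagnetic

variable {w : Config n → ℝ} {u : EdgeSet n → Config n → ℝ} (hw : IsFerromagnetic w u)
  {l r lam K δ : ℝ}
include hw

lemma expect_outside_raise_le {D : ℕ} (hδ : ∀ g, expect w (fun x => outside l r (u g x)) ≤ δ)
    (g : EdgeSet n) {B : Finset (EdgeSet n)} (hB : B.card ≤ D) :
    expect w (fun x => outside l r (u g (raise B x))) ≤ 2 ^ D * δ := by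
  have h := hw.expect_raise_le B (f := fun x => outside l r (u g x)) fun x => outside_nonneg _ _ _
  have h0 : 0 ≤ expect w (fun x => outside l r (u g x)) := by
    have := expect_mono hw.nonneg (f := fun _ => 0) fun x => outside_nonneg l r (u g x)
    rwa [expect_const hw.sum_eq_one] at this
  refine h.trans (mul_le_mul ?_ (hδ g) h0 (by positivity))
  exact pow_le_pow_right₀ one_le_two hB

/-- The covariance of the edge count with a truncated conditional probability is controlled by the
Lipschitz constant of `Phi` on the truncation window. -/
lemma cov_Phi_clamp_le {D : ℕ} (hlr : l ≤ r) (hlam : 0 ≤ lam)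
    (hlip : ∀ a b, l ≤ a → a ≤ b → b ≤ r → Phi b - Phi a ≤ lam * (b - a))
    (hl : |l| ≤ K) (hr : |r| ≤ K) (hu : ∀ g x, u g x ≤ K)
    (hδ : ∀ g, expect w (fun x => outside l r (u g x)) ≤ δ)
    (g : EdgeSet n) {B : Finset (EdgeSet n)} (hB : B.card ≤ D) :
    cov w edgeCount (fun x => Phi (clamp l r (u g (raise B x)))) ≤
      lam * (cov w edgeCount (fun x => u g (raise B x)) +
        2 * K * (Fintype.card (EdgeSet n) * (2 ^ D * δ))) := by
  have h1 : cov w edgeCount (fun x => Phi (clamp l r (u g (raise B x)))) ≤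
      cov w edgeCount (fun x => lam * clamp l r (u g (raise B x))) := by
    refine hw.cov_edgeCount_le fun x y h => ?_
    have := hlip _ _ (le_clamp l r _)
      (clamp_mono l r (hw.field_mono g (raise_mono B h))) (clamp_le hlr _)
    linarith
  rw [cov_const_mul hw.sum_eq_one] at h1
  refine h1.trans (mul_le_mul_of_nonneg_left ?_ hlam)
  refine (hw.cov_edgeCount_le_add _ fun x => u g (raise B x)).trans (add_le_add le_rfl ?_)
  have h2 : expect w (fun x => |clamp l r (u g (raise B x)) - u g (raise B x)|) ≤
      2 * K * (2 ^ D * δ) := by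
    refine le_trans (expect_mono hw.nonneg fun x => ?_)
      ((expect_const_mul (2 * K) fun x => outside l r (u g (raise B x))).trans_le
        (mul_le_mul_of_nonneg_left (hw.expect_outside_raise_le hδ g hB)
          (mul_nonneg zero_le_two ((abs_nonneg _).trans hl))))
    rw [abs_sub_comm]
    exact abs_sub_clamp_le hlr hl hr (hw.field_nonneg _ _) (hu _ _)
  refine (mul_le_mul_of_nonneg_left h2 (Nat.cast_nonneg _)).trans_eq (by ring)

lemma cov_edgeX_le {D : ℕ} (hlr : l ≤ r) (hlam : 0 ≤ lam)
    (hlip : ∀ a b, l ≤ a → a ≤ b → b ≤ r → Phi b - Phi a ≤ lam * (b - a))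
    (hl : |l| ≤ K) (hr : |r| ≤ K) (hu : ∀ g x, u g x ≤ K)
    (hδ : ∀ g, expect w (fun x => outside l r (u g x)) ≤ δ) (g : EdgeSet n) :
    cov w edgeCount (edgeX g) ≤ 1 + Fintype.card (EdgeSet n) * (2 ^ D * δ) +
      lam * (cov w edgeCount (u g) +
        2 * K * (Fintype.card (EdgeSet n) * (2 ^ D * δ))) := by
  have h1 := hw.cov_edgeCount_le_resample g (edgeX_nonneg g) (edgeX_le_one g)
  have h2 : resample (fun x => Phi (u g x)) g (edgeX g) = fun x => Phi (u g x) := by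
    funext x
    simp [resample, edgeX_update_self]
  rw [h2] at h1
  have h3 := hw.cov_edgeCount_le_add (fun x => Phi (u g x)) fun x => Phi (clamp l r (u g x))
  have hB : (∅ : Finset (EdgeSet n)).card ≤ D := by simp
  have h4 := hw.cov_Phi_clamp_le hlr hlam hlip hl hr hu hδ g hB
  have h5 := hw.expect_outside_raise_le hδ g hB
  simp only [raise_empty] at h4 h5
  have h6 := (expect_mono hw.nonneg fun x => abs_Phi_sub_clamp_le l r (u g x)).trans h5
  have h7 := mul_le_mul_of_nonneg_left h6 (Nat.cast_nonneg (α := ℝ) (Fintype.card (EdgeSet n)))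
  change _ ≤ _ + lam * (cov w edgeCount (fun x => u g x) + _)
  linarith

lemma cov_mon_le {D : ℕ} {κ : ℝ} (hlr : l ≤ r) (hlam : 0 ≤ lam)
    (hlip : ∀ a b, l ≤ a → a ≤ b → b ≤ r → Phi b - Phi a ≤ lam * (b - a))
    (hl : |l| ≤ K) (hr : |r| ≤ K) (hu : ∀ g x, u g x ≤ K)
    (hδ : ∀ g, expect w (fun x => outside l r (u g x)) ≤ δ)
    (hκ : ∀ g (B : Finset (EdgeSet n)), B.card ≤ D →
      cov w edgeCount (fun x => u g (raise B x)) ≤ κ)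
    {B : Finset (EdgeSet n)} (hB : B.card ≤ D) :
    cov w edgeCount (mon B) ≤ B.card + B.card * (Fintype.card (EdgeSet n) * (2 ^ D * δ)) +
      B.card * Phi r ^ (B.card - 1) *
        (lam * (κ + 2 * K * (Fintype.card (EdgeSet n) * (2 ^ D * δ)))) := by
  obtain ⟨J, hlen, hcard, hle⟩ := hw.exists_cov_mon_mul_le B 0 [] (by simp)
  simp only [List.length_nil, zero_add] at hlen hcard
  simp only [List.map_nil, List.prod_nil, mul_one] at hle
  have hD : ∀ p ∈ J, p.2.card ≤ D := fun p hp => (hcard p hp).trans hB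
  set h : EdgeSet n × Finset (EdgeSet n) → Config n → ℝ :=
    fun p x => Phi (u p.1 (raise p.2 x)) with hh
  set v : EdgeSet n × Finset (EdgeSet n) → Config n → ℝ :=
    fun p x => Phi (clamp l r (u p.1 (raise p.2 x))) with hv
  have h1 := hw.cov_edgeCount_le_add (fun x => (J.map fun p => h p x).prod)
    fun x => (J.map fun p => v p x).prod
  have h2 : expect w (fun x => |(J.map fun p => h p x).prod - (J.map fun p => v p x).prod|) ≤
      J.length * (2 ^ D * δ) := by
    refine (expect_mono hw.nonneg fun x => (abs_list_prod_sub_le J (fun p => h p x)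
      (fun p => v p x) (fun _ => ⟨Phi_nonneg _, Phi_le_one _⟩)
      (fun _ => ⟨Phi_nonneg _, Phi_le_one _⟩)).trans
      (List.sum_le_sum fun p _ => abs_Phi_sub_clamp_le l r (u p.1 (raise p.2 x)))).trans ?_
    clear h1 hle hlen hcard
    induction J with
    | nil => simp [expect_const hw.sum_eq_one]
    | cons a J ih =>
      simp only [List.map_cons, List.sum_cons, List.length_cons]
      rw [expect_add]
      have := ih fun p hp => hD p (List.mem_cons_of_mem _ hp)
      have := hw.expect_outside_raise_le hδ a.1 (hD a List.mem_cons_self)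
      push_cast
      linarith
  have h3 := hw.cov_edgeCount_list_prod_le (Phi_nonneg r) J v
    (fun p _ x y hxy => Phi_monotone
      (clamp_mono l r (hw.field_mono p.1 (raise_mono p.2 hxy))))
    (fun p _ x => Phi_nonneg _) (fun p _ x => Phi_monotone (clamp_le hlr _))
    (fun p hp => (hw.cov_Phi_clamp_le hlr hlam hlip hl hr hu hδ p.1 (hD p hp)).trans
      (mul_le_mul_of_nonneg_left (add_le_add (hκ p.1 p.2 (hD p hp)) le_rfl) hlam))
  have h4 := mul_le_mul_of_nonneg_left h2 (Nat.cast_nonneg (α := ℝ) (Fintype.card (EdgeSet n)))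
  rw [hlen] at h3 h4
  change cov w edgeCount (fun x => mon B x) ≤ _
  linarith

end IsFerromagnetic

section Polynomial

variable {ι : Type*} [Fintype ι] {W : ι → ℝ} {A : ι → Finset (EdgeSet n)} {w : Config n → ℝ}

lemma mon_raise (B C : Finset (EdgeSet n)) (x : Config n) :
    mon B (raise C x) = mon (B \ C) x := by
  simp only [mon_eq_ite, raise, Finset.mem_sdiff, Bool.or_eq_true, decide_eq_true_eq]
  congr 1
  refine propext ⟨fun h g hg => (h g hg.1).resolve_right hg.2, fun h g hg => ?_⟩
  by_cases hC : g ∈ C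
  · exact Or.inr hC
  · exact Or.inl (h g ⟨hg, hC⟩)

lemma cov_field_raise_le (hw : IsFerromagnetic w (field W A)) (hW : ∀ α, 0 ≤ W α) {D : ℕ}
    (hA : ∀ α, (A α).card ≤ D) {η a : ℝ} (ha0 : 0 ≤ a)
    (hη : ∀ g h, g ≠ h → ∑ α with g ∈ A α ∧ h ∈ A α, W α ≤ η)
    (ha : ∀ g, cov w edgeCount (edgeX g) ≤ a) (g : EdgeSet n) {B : Finset (EdgeSet n)}
    (hB : B.card ≤ D) (hη0 : 0 ≤ η) :
    cov w edgeCount (fun x => field W A g (raise B x)) ≤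
      cov w edgeCount (field W A g) + D * η * (D * a) := by
  have h1 : (fun x => field W A g (raise B x)) =
      fun x => ∑ α with g ∈ A α, W α * mon ((A α).erase g \ B) x := by
    funext x
    simp only [field, mon_raise]
  have h2 : field W A g = fun x => ∑ α with g ∈ A α, W α * mon ((A α).erase g) x := rfl
  rw [h1, h2, cov_sum hw.sum_eq_one, cov_sum hw.sum_eq_one]
  simp only [cov_const_mul hw.sum_eq_one]
  have hterm : ∀ α, W α * cov w edgeCount (fun x => mon ((A α).erase g \ B) x) ≤
      W α * cov w edgeCount (fun x => mon ((A α).erase g) x) +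
        ∑ h ∈ B.erase g, if h ∈ A α then W α * (D * a) else 0 := by
    intro α
    have hDa : 0 ≤ W α * (D * a) := mul_nonneg (hW α) (mul_nonneg (Nat.cast_nonneg _) ha0)
    by_cases hd : ∃ h ∈ B.erase g, h ∈ A α
    · obtain ⟨h, hh, hhA⟩ := hd
      have hs : W α * (D * a) ≤ ∑ h ∈ B.erase g, if h ∈ A α then W α * (D * a) else 0 := by
        refine le_trans (by rw [if_pos hhA]) (single_le_sum (f := fun h =>
          if h ∈ A α then W α * (D * a) else 0) (fun i _ => ?_) hh)
        split_ifs <;> simp [hDa]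
      have hm := hw.cov_edgeCount_mon_le_sum ((A α).erase g \ B) ha
      have hc : (((A α).erase g \ B).card : ℝ) ≤ D := by
        exact_mod_cast (card_le_card (sdiff_subset.trans (erase_subset _ _))).trans (hA α)
      have h0 := hw.cov_nonneg _ _ edgeCount_mono (mon_mono ((A α).erase g))
      have := mul_le_mul_of_nonneg_left (hm.trans (mul_le_mul_of_nonneg_right hc ha0)) (hW α)
      have := mul_nonneg (hW α) h0
      change W α * cov w edgeCount (mon ((A α).erase g \ B)) ≤
        W α * cov w edgeCount (mon ((A α).erase g)) + _
      linarith
    · have hsd : (A α).erase g \ B = (A α).erase g := by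
        rw [Finset.sdiff_eq_self_iff_disjoint, disjoint_left]
        intro h hhB hh
        exact hd ⟨h, mem_erase.mpr ⟨(mem_erase.mp hhB).1, hh⟩, (mem_erase.mp hhB).2⟩
      rw [hsd]
      exact le_add_of_nonneg_right (sum_nonneg fun i _ => by split_ifs <;> simp [hDa])
  refine (sum_le_sum fun α _ => hterm α).trans ?_
  rw [sum_add_distrib]
  refine add_le_add le_rfl ?_
  rw [sum_comm]
  have hin : ∀ h ∈ B.erase g, (∑ α with g ∈ A α, if h ∈ A α then W α * (D * a) else 0) ≤
      η * (D * a) := by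
    intro h hh
    rw [← sum_filter, filter_filter, ← sum_mul]
    exact mul_le_mul_of_nonneg_right (hη g h (ne_of_mem_erase hh).symm)
      (mul_nonneg (Nat.cast_nonneg _) ha0)
  refine (sum_le_card_nsmul _ _ _ hin).trans ?_
  rw [nsmul_eq_mul, mul_assoc]
  refine mul_le_mul_of_nonneg_right ?_ (mul_nonneg hη0 (mul_nonneg (Nat.cast_nonneg _) ha0))
  exact_mod_cast (card_le_card (erase_subset _ _)).trans hB

/-- Uniform bound on the covariances of the edge count with the edges, provided all the local
fields stay, with high probability, in a window on which the linearised recursion contracts. -/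
lemma cov_edgeCount_edgeX_le_of_contraction (hw : IsFerromagnetic w (field W A))
    (hW : ∀ α, 0 ≤ W α) {D : ℕ} (hA : ∀ α, (A α).card ≤ D) {η δ l r lam K T ρ : ℝ}
    (hη : ∀ g h, g ≠ h → ∑ α with g ∈ A α ∧ h ∈ A α, W α ≤ η) (hη0 : 0 ≤ η)
    (hlr : l ≤ r) (hlam : 0 ≤ lam)
    (hlip : ∀ a b, l ≤ a → a ≤ b → b ≤ r → Phi b - Phi a ≤ lam * (b - a))
    (hl : |l| ≤ K) (hr : |r| ≤ K) (hK : ∀ g, ∑ α with g ∈ A α, W α ≤ K)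
    (hδ : ∀ g, expect w (fun x => outside l r (field W A g x)) ≤ δ)
    (hT : ∀ g, ∑ α with g ∈ A α, W α * (((A α).card - 1 : ℕ) *
      Phi r ^ ((A α).card - 1 - 1)) ≤ T) (hT0 : 0 ≤ T)
    (hτ : Fintype.card (EdgeSet n) * (2 ^ D * δ) ≤ 1)
    (hDη : D * η * D ≤ 1) (hρ : T * lam * (1 + D * η * D * lam) ≤ ρ) (hρ1 : ρ < 1)
    (e : EdgeSet n) :
    cov w edgeCount (edgeX e) ≤
      2 + lam * ((T * lam * (2 + 2 * K * lam + 2 * K) + 2 * K * D) / (1 - ρ) + 2 * K) := by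
  have hK0 : 0 ≤ K := (abs_nonneg _).trans hl
  have hu : ∀ g x, field W A g x ≤ K := fun g x =>
    (sum_le_sum fun α _ => mul_le_of_le_one_right (hW α) (mon_le_one _ x)).trans (hK g)
  set τ : ℝ := Fintype.card (EdgeSet n) * (2 ^ D * δ) with hτdef
  obtain ⟨g₀, -, hmax⟩ := exists_max_image univ (fun g => cov w edgeCount (field W A g))
    ⟨e, mem_univ e⟩
  set c := cov w edgeCount (field W A g₀) with hc
  have hcg : ∀ g, cov w edgeCount (field W A g) ≤ c := fun g => hmax g (mem_univ g)
  have hc0 : 0 ≤ c := hw.cov_nonneg _ _ edgeCount_mono (hw.field_mono g₀)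
  set a : ℝ := 2 + lam * (c + 2 * K) with ha
  have ha0 : 0 ≤ a := by positivity
  have haX : ∀ g, cov w edgeCount (edgeX g) ≤ a := by
    intro g
    refine (hw.cov_edgeX_le (D := D) hlr hlam hlip hl hr hu hδ g).trans ?_
    have : lam * (cov w edgeCount (field W A g) + 2 * K * τ) ≤ lam * (c + 2 * K) :=
      mul_le_mul_of_nonneg_left (add_le_add (hcg g)
        (mul_le_of_le_one_right (by positivity) hτ)) hlam
    linarith
  have hκ : ∀ g (B : Finset (EdgeSet n)), B.card ≤ D →
      cov w edgeCount (fun x => field W A g (raise B x)) ≤ c + D * η * (D * a) :=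
    fun g B hB => (cov_field_raise_le hw hW hA ha0 hη haX g hB hη0).trans
      (add_le_add (hcg g) le_rfl)
  have hmon : ∀ α, cov w edgeCount (fun x => mon ((A α).erase g₀) x) ≤ 2 * D +
      (((A α).erase g₀).card * Phi r ^ (((A α).erase g₀).card - 1)) *
        (lam * (c + D * η * (D * a) + 2 * K)) := by
    intro α
    have hcard : ((A α).erase g₀).card ≤ D := (card_le_card (erase_subset _ _)).trans (hA α)
    refine (hw.cov_mon_le hlr hlam hlip hl hr hu hδ hκ hcard).trans ?_
    have hcard' : (((A α).erase g₀).card : ℝ) ≤ D := by exact_mod_cast hcard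
    have h1 := mul_le_of_le_one_right (Nat.cast_nonneg (α := ℝ) ((A α).erase g₀).card) hτ
    have h2 : lam * (c + D * η * (D * a) + 2 * K * τ) ≤
        lam * (c + D * η * (D * a) + 2 * K) :=
      mul_le_mul_of_nonneg_left (add_le_add le_rfl
        (mul_le_of_le_one_right (by positivity) hτ)) hlam
    have h3 := mul_le_mul_of_nonneg_left h2 (mul_nonneg
      (Nat.cast_nonneg (α := ℝ) ((A α).erase g₀).card)
      (pow_nonneg (Phi_nonneg r) (((A α).erase g₀).card - 1)))
    linarith
  have hrec : c ≤ T * (lam * (c + D * η * (D * a) + 2 * K)) + 2 * K * D := by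
    have h2 : field W A g₀ = fun x => ∑ α with g₀ ∈ A α, W α * mon ((A α).erase g₀) x := rfl
    have hnn : 0 ≤ lam * (c + D * η * (D * a) + 2 * K) := by positivity
    calc c = ∑ α with g₀ ∈ A α, W α * cov w edgeCount (fun x => mon ((A α).erase g₀) x) := by
          rw [hc, h2, cov_sum hw.sum_eq_one]
          simp only [cov_const_mul hw.sum_eq_one]
      _ ≤ ∑ α with g₀ ∈ A α, (W α * (((A α).card - 1 : ℕ) * Phi r ^ ((A α).card - 1 - 1)) *
            (lam * (c + D * η * (D * a) + 2 * K)) + W α * (2 * D)) := by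
          refine sum_le_sum fun α hα => ?_
          have := mul_le_mul_of_nonneg_left (hmon α) (hW α)
          rw [card_erase_of_mem (mem_filter.mp hα).2] at this
          linarith
      _ ≤ _ := by
          rw [sum_add_distrib, ← sum_mul, ← sum_mul]
          have h3 := mul_le_mul_of_nonneg_right (hT g₀) hnn
          have h4 := mul_le_mul_of_nonneg_right (hK g₀)
            (show (0 : ℝ) ≤ 2 * D by positivity)
          linarith
  have hTlam : 0 ≤ T * lam := mul_nonneg hT0 hlam
  have h5 : T * lam * (D * η * D * (2 + 2 * K * lam)) ≤ T * lam * (2 + 2 * K * lam) :=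
    mul_le_mul_of_nonneg_left (mul_le_of_le_one_left (by positivity) hDη) hTlam
  have h6 : c * (1 - ρ) ≤ T * lam * (2 + 2 * K * lam + 2 * K) + 2 * K * D := by
    have h7 := mul_le_mul_of_nonneg_right hρ hc0
    have h8 : T * (lam * (c + D * η * (D * a) + 2 * K)) =
        T * lam * (1 + D * η * D * lam) * c + T * lam * (D * η * D * (2 + 2 * K * lam)) +
          T * lam * (2 * K) := by
      rw [ha]; ring
    linarith
  have h9 : c ≤ (T * lam * (2 + 2 * K * lam + 2 * K) + 2 * K * D) / (1 - ρ) :=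
    (le_div_iff₀ (by linarith)).mpr h6
  refine (haX e).trans ?_
  rw [ha]
  gcongr

end Polynomial

end Contraction

/-! ### Comparison with product measures -/

section Product

variable {n : ℕ} {q : ℝ}

/-- Resample successively the edges of a list, each being present with probability `q`. -/
noncomputable def resampleAll (q : ℝ) :
    List (EdgeSet n) → (Config n → ℝ) → Config n → ℝ
  | [], f => f
  | g :: L, f => resampleAll q L (resample (fun _ => q) g f)

lemma resample_const_mono (hq0 : 0 ≤ q) (hq1 : q ≤ 1) (g : EdgeSet n) {f f' : Config n → ℝ}
    (h : ∀ x, f x ≤ f' x) (x : Config n) :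
    resample (fun _ => q) g f x ≤ resample (fun _ => q) g f' x :=
  add_le_add (mul_le_mul_of_nonneg_left (h _) hq0)
    (mul_le_mul_of_nonneg_left (h _) (sub_nonneg.mpr hq1))

lemma resampleAll_mono (hq0 : 0 ≤ q) (hq1 : q ≤ 1) (L : List (EdgeSet n))
    {f f' : Config n → ℝ} (h : ∀ x, f x ≤ f' x) (x : Config n) :
    resampleAll q L f x ≤ resampleAll q L f' x := by
  induction L generalizing f f' with
  | nil => exact h x
  | cons g L ih => exact ih (resample_const_mono hq0 hq1 g h)

lemma resampleAll_add_const (L : List (EdgeSet n)) (f : Config n → ℝ) (c : ℝ) (x : Config n) :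
    resampleAll q L (fun y => f y + c) x = resampleAll q L f x + c := by
  induction L generalizing f with
  | nil => rfl
  | cons g L ih =>
    rw [resampleAll, resampleAll, ← ih]
    congr 1
    funext y
    simp only [resample]
    ring

lemma resampleAll_const_mul (L : List (EdgeSet n)) (c : ℝ) (f : Config n → ℝ) (x : Config n) :
    resampleAll q L (fun y => c * f y) x = c * resampleAll q L f x := by
  induction L generalizing f with
  | nil => rfl
  | cons g L ih =>
    rw [resampleAll, resampleAll, ← ih]
    congr 1
    funext y
    simp only [resample]
    ring

lemma resampleAll_sum {κ : Type*} (s : Finset κ) (L : List (EdgeSet n))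
    (f : κ → Config n → ℝ) (x : Config n) :
    resampleAll q L (fun y => ∑ a ∈ s, f a y) x = ∑ a ∈ s, resampleAll q L (f a) x := by
  induction L generalizing f with
  | nil => rfl
  | cons g L ih =>
    simp only [resampleAll]
    rw [← ih]
    congr 1
    funext y
    simp only [resample, mul_sum, sum_add_distrib]

lemma resample_const_mon (g : EdgeSet n) (B : Finset (EdgeSet n)) :
    resample (fun _ => q) g (mon B) =
      if g ∈ B then fun x => q * mon (B.erase g) x else mon B := by
  funext x
  split_ifs with h
  · simp [resample, mon_eq_mul_erase h, edgeX_update_self,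
      mon_update_of_notMem (notMem_erase g B)]
  · simp only [resample, mon_update_of_notMem h]
    ring

lemma resampleAll_mon {L : List (EdgeSet n)} {B : Finset (EdgeSet n)} (h : ∀ g ∈ B, g ∈ L)
    (x : Config n) : resampleAll q L (mon B) x = q ^ B.card := by
  induction L generalizing B with
  | nil =>
    have : B = ∅ := eq_empty_of_forall_notMem fun g hg => by simpa using h g hg
    simp [this, resampleAll, mon]
  | cons g L ih =>
    rw [resampleAll, resample_const_mon]
    split_ifs with hg
    · rw [resampleAll_const_mul, ih, ← card_erase_add_one hg, pow_succ']
      intro k hk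
      exact (List.mem_cons.mp (h k (mem_of_mem_erase hk))).resolve_left (ne_of_mem_erase hk)
    · refine ih fun k hk => (List.mem_cons.mp (h k hk)).resolve_left ?_
      rintro rfl
      exact hg hk

lemma resampleAll_univ_field {ι : Type*} [Fintype ι] (W : ι → ℝ)
    (A : ι → Finset (EdgeSet n)) (e : EdgeSet n) (x : Config n) :
    resampleAll q univ.toList (field W A e) x =
      ∑ α with e ∈ A α, W α * q ^ ((A α).card - 1) := by
  unfold field
  rw [resampleAll_sum]
  refine sum_congr rfl fun α hα => ?_
  rw [resampleAll_const_mul, resampleAll_mon (fun g _ => mem_toList.mpr (mem_univ g)),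
    card_erase_of_mem (mem_filter.mp hα).2]

lemma exp_le_one_add_add_sq {t : ℝ} (ht : |t| ≤ 1) : Real.exp t ≤ 1 + t + t ^ 2 := by
  have := (abs_le.mp (Real.abs_exp_sub_one_sub_id_le ht)).2
  linarith

lemma weighted_exp_le (hq0 : 0 ≤ q) (hq1 : q ≤ 1) {a b c : ℝ} (hab : |a - b| ≤ c)
    (hc : c ≤ 1) :
    q * Real.exp a + (1 - q) * Real.exp b ≤ Real.exp (q * a + (1 - q) * b + c ^ 2) := by
  set m := q * a + (1 - q) * b with hm
  have hsq : (a - b) ^ 2 ≤ c ^ 2 := sq_le_sq' (by linarith [(abs_le.mp hab).1]) (abs_le.mp hab).2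
  have h1 : a - m = (1 - q) * (a - b) := by rw [hm]; ring
  have h2 : b - m = -q * (a - b) := by rw [hm]; ring
  have ha : |a - m| ≤ 1 := by
    rw [h1, abs_mul, abs_of_nonneg (sub_nonneg.mpr hq1)]
    nlinarith [abs_nonneg (a - b)]
  have hb : |b - m| ≤ 1 := by
    rw [h2, abs_mul, abs_neg, abs_of_nonneg hq0]
    nlinarith [abs_nonneg (a - b)]
  have ea : Real.exp a = Real.exp m * Real.exp (a - m) := by rw [← Real.exp_add]; ring_nf
  have eb : Real.exp b = Real.exp m * Real.exp (b - m) := by rw [← Real.exp_add]; ring_nf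
  have hpos := Real.exp_pos m
  calc q * Real.exp a + (1 - q) * Real.exp b
      = Real.exp m * (q * Real.exp (a - m) + (1 - q) * Real.exp (b - m)) := by
        rw [ea, eb]; ring
    _ ≤ Real.exp m * (q * (1 + (a - m) + (a - m) ^ 2) +
          (1 - q) * (1 + (b - m) + (b - m) ^ 2)) := by
        gcongr
        · exact exp_le_one_add_add_sq ha
        · exact exp_le_one_add_add_sq hb
    _ ≤ Real.exp m * (1 + c ^ 2) := by
        refine mul_le_mul_of_nonneg_left ?_ hpos.le
        rw [h1, h2]
        nlinarith [mul_nonneg hq0 (sub_nonneg.mpr hq1), sq_nonneg (a - b),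
          mul_nonneg (sub_nonneg.mpr hq1) (sq_nonneg (a - b)),
          mul_nonneg (mul_self_nonneg q) (sq_nonneg (a - b))]
    _ ≤ Real.exp m * Real.exp (c ^ 2) := by
        gcongr
        linarith [Real.add_one_le_exp (c ^ 2)]
    _ = _ := by rw [← Real.exp_add]

/-- `c g` bounds the influence of the edge `g` on `f`. -/
def HasInfluence (f : Config n → ℝ) (c : EdgeSet n → ℝ) : Prop :=
  ∀ g x, |f (Function.update x g true) - f (Function.update x g false)| ≤ c g

lemma HasInfluence.resample {f : Config n → ℝ} {c : EdgeSet n → ℝ} (hf : HasInfluence f c)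
    (hq0 : 0 ≤ q) (hq1 : q ≤ 1) (h : EdgeSet n) :
    HasInfluence (resample (fun _ => q) h f) c := by
  intro g x
  have hc : 0 ≤ c g := (abs_nonneg _).trans (hf g x)
  by_cases hgh : g = h
  · subst hgh
    simpa [ERGM.resample, Function.update_idem] using hc
  · simp only [ERGM.resample, Function.update_comm hgh]
    have h1 := abs_le.mp (hf g (Function.update x h true))
    have h2 := abs_le.mp (hf g (Function.update x h false))
    rw [abs_le]
    constructor <;> nlinarith [h1.1, h1.2, h2.1, h2.2]

lemma resampleAll_exp_le (hq0 : 0 ≤ q) (hq1 : q ≤ 1) {f : Config n → ℝ} {c : EdgeSet n → ℝ}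
    (hf : HasInfluence f c) (hc : ∀ g, c g ≤ 1) (L : List (EdgeSet n)) (x : Config n) :
    resampleAll q L (fun y => Real.exp (f y)) x ≤
      Real.exp (resampleAll q L f x + (L.map fun g => c g ^ 2).sum) := by
  induction L generalizing f with
  | nil => simp [resampleAll]
  | cons g L ih =>
    rw [resampleAll, resampleAll, List.map_cons, List.sum_cons, ← add_assoc]
    have hf' : HasInfluence (fun y => resample (fun _ => q) g f y + c g ^ 2) c := by
      intro k y
      rw [add_sub_add_right_eq_sub]
      exact hf.resample hq0 hq1 g k y
    have := ih hf'
    rw [resampleAll_add_const] at this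
    refine le_trans (resampleAll_mono hq0 hq1 L (fun y => ?_) x) this
    exact weighted_exp_le hq0 hq1 (hf g y) (hc g)

lemma expect_le_expect_resampleAll {w : Config n → ℝ} (P : (Config n → ℝ) → Prop)
    (hP : ∀ f g, P f → P (resample (fun _ => q) g f)) {δ : ℝ}
    (h : ∀ f g, P f → expect w f ≤ expect w (resample (fun _ => q) g f) + δ)
    (L : List (EdgeSet n)) {f : Config n → ℝ} (hf : P f) :
    expect w f ≤ expect w (resampleAll q L f) + L.length * δ := by
  induction L generalizing f with
  | nil => simp [resampleAll]
  | cons g L ih =>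
    have h1 := h f g hf
    have h2 := ih (hP f g hf)
    rw [resampleAll, List.length_cons]
    push_cast
    linarith

lemma resample_const_mem_Icc (hq0 : 0 ≤ q) (hq1 : q ≤ 1) {f : Config n → ℝ}
    (hf : ∀ x, f x ∈ Set.Icc (0 : ℝ) 1) (g : EdgeSet n) (x : Config n) :
    resample (fun _ => q) g f x ∈ Set.Icc (0 : ℝ) 1 := by
  have h1 := hf (Function.update x g true)
  have h2 := hf (Function.update x g false)
  simp only [resample, Set.mem_Icc] at *
  constructor <;> nlinarith

lemma update_mono_config (g : EdgeSet n) (b : Bool) :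
    Monotone fun x : Config n => Function.update x g b := by
  intro x y h k
  by_cases hk : k = g
  · subst hk; simp
  · simpa [Function.update_of_ne hk] using h k

lemma resample_const_monotone (hq0 : 0 ≤ q) (hq1 : q ≤ 1) {f : Config n → ℝ}
    (hf : Monotone f) (g : EdgeSet n) : Monotone (resample (fun _ => q) g f) :=
  fun _ _ h => add_le_add (mul_le_mul_of_nonneg_left (hf (update_mono_config g _ h)) hq0)
    (mul_le_mul_of_nonneg_left (hf (update_mono_config g _ h)) (sub_nonneg.mpr hq1))

lemma resample_const_antitone (hq0 : 0 ≤ q) (hq1 : q ≤ 1) {f : Config n → ℝ}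
    (hf : Antitone f) (g : EdgeSet n) : Antitone (resample (fun _ => q) g f) :=
  fun _ _ h => add_le_add (mul_le_mul_of_nonneg_left (hf (update_mono_config g _ h)) hq0)
    (mul_le_mul_of_nonneg_left (hf (update_mono_config g _ h)) (sub_nonneg.mpr hq1))

lemma update_false_le_update_true (g : EdgeSet n) (x : Config n) :
    Function.update x g false ≤ Function.update x g true := by
  intro k
  by_cases hk : k = g
  · subst hk; simp
  · simp [Function.update_of_ne hk]

/-- The real-valued indicator of a proposition. -/
noncomputable def indic (P : Prop) [Decidable P] : ℝ := if P then 1 else 0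

lemma IsFerromagnetic.expect_le_of_monotone {w : Config n → ℝ} {u : EdgeSet n → Config n → ℝ}
    (hw : IsFerromagnetic w u) (hq0 : 0 ≤ q) (hq1 : q ≤ 1) {δ : ℝ}
    (hδ : ∀ g, expect w (fun x => indic (q < Phi (u g x))) ≤ δ) {f : Config n → ℝ}
    (hf : Monotone f) (hf01 : ∀ x, f x ∈ Set.Icc (0 : ℝ) 1) :
    expect w f ≤ expect w (resampleAll q univ.toList f) + Fintype.card (EdgeSet n) * δ := by
  have := expect_le_expect_resampleAll (q := q) (w := w) (δ := δ)
    (fun f => Monotone f ∧ ∀ x, f x ∈ Set.Icc (0 : ℝ) 1)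
    (fun f g hf => ⟨resample_const_monotone hq0 hq1 hf.1 g,
      resample_const_mem_Icc hq0 hq1 hf.2 g⟩) ?_ univ.toList ⟨hf, hf01⟩
  · simpa using this
  · rintro f g ⟨hm, h01⟩
    rw [← hw.expect_resample g f]
    refine (expect_mono hw.nonneg fun x => ?_).trans ((expect_add _ _).le.trans
      (add_le_add le_rfl (hδ g)))
    have h1 := h01 (Function.update x g true)
    have h2 := h01 (Function.update x g false)
    have h3 := hm (update_false_le_update_true g x)
    simp only [resample, indic, Set.mem_Icc] at *
    split_ifs with h
    · nlinarith [Phi_le_one (u g x)]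
    · nlinarith

lemma IsFerromagnetic.expect_le_of_antitone {w : Config n → ℝ} {u : EdgeSet n → Config n → ℝ}
    (hw : IsFerromagnetic w u) (hq0 : 0 ≤ q) (hq1 : q ≤ 1) {δ : ℝ}
    (hδ : ∀ g, expect w (fun x => indic (Phi (u g x) < q)) ≤ δ) {f : Config n → ℝ}
    (hf : Antitone f) (hf01 : ∀ x, f x ∈ Set.Icc (0 : ℝ) 1) :
    expect w f ≤ expect w (resampleAll q univ.toList f) + Fintype.card (EdgeSet n) * δ := by
  have := expect_le_expect_resampleAll (q := q) (w := w) (δ := δ)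
    (fun f => Antitone f ∧ ∀ x, f x ∈ Set.Icc (0 : ℝ) 1)
    (fun f g hf => ⟨resample_const_antitone hq0 hq1 hf.1 g,
      resample_const_mem_Icc hq0 hq1 hf.2 g⟩) ?_ univ.toList ⟨hf, hf01⟩
  · simpa using this
  · rintro f g ⟨hm, h01⟩
    rw [← hw.expect_resample g f]
    refine (expect_mono hw.nonneg fun x => ?_).trans ((expect_add _ _).le.trans
      (add_le_add le_rfl (hδ g)))
    have h1 := h01 (Function.update x g true)
    have h2 := h01 (Function.update x g false)
    have h3 := hm (update_false_le_update_true g x)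
    simp only [resample, indic, Set.mem_Icc] at *
    split_ifs with h
    · nlinarith [Phi_nonneg (u g x)]
    · nlinarith

section Field

variable {ι : Type*} [Fintype ι] {W : ι → ℝ} {A : ι → Finset (EdgeSet n)}

lemma field_hasInfluence (hW : ∀ α, 0 ≤ W α) (e : EdgeSet n) (s b : ℝ) :
    HasInfluence (fun x => s * field W A e x + b)
      (fun g => |s| * ∑ α with e ∈ A α ∧ g ∈ (A α).erase e, W α) := by
  intro g x
  have h : (s * field W A e (Function.update x g true) + b) -
      (s * field W A e (Function.update x g false) + b) =
      s * ∑ α with e ∈ A α, W α * (mon ((A α).erase e) (Function.update x g true) -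
        mon ((A α).erase e) (Function.update x g false)) := by
    simp only [field, mul_sub, sum_sub_distrib]
    ring
  dsimp only
  rw [h, abs_mul]
  refine mul_le_mul_of_nonneg_left ((abs_sum_le_sum_abs _ _).trans ?_) (abs_nonneg s)
  rw [← filter_filter, sum_filter (s := univ.filter fun α => e ∈ A α)]
  refine sum_le_sum fun α _ => ?_
  split_ifs with hg
  · rw [abs_mul, abs_of_nonneg (hW α)]
    refine mul_le_of_le_one_right (hW α) (abs_le.mpr ⟨?_, ?_⟩)
    · linarith [mon_nonneg ((A α).erase e) (Function.update x g true),
        mon_le_one ((A α).erase e) (Function.update x g false)]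
    · linarith [mon_nonneg ((A α).erase e) (Function.update x g false),
        mon_le_one ((A α).erase e) (Function.update x g true)]
  · rw [mon_update_of_notMem hg, mon_update_of_notMem hg]
    simp

variable {D : ℕ} {η K : ℝ}

lemma sum_influence_le (hW : ∀ α, 0 ≤ W α) (hA : ∀ α, (A α).card ≤ D)
    (hK : ∀ g, ∑ α with g ∈ A α, W α ≤ K) (e : EdgeSet n) :
    ∑ g, ∑ α with e ∈ A α ∧ g ∈ (A α).erase e, W α ≤ D * K := by
  simp only [← filter_filter, sum_filter (s := univ.filter fun α => e ∈ A α)]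
  rw [sum_comm]
  calc ∑ α with e ∈ A α, ∑ g, (if g ∈ (A α).erase e then W α else 0)
      ≤ ∑ α with e ∈ A α, D * W α := by
        refine sum_le_sum fun α _ => ?_
        rw [← sum_filter, sum_const, nsmul_eq_mul]
        refine mul_le_mul_of_nonneg_right ?_ (hW α)
        rw [filter_univ_mem]
        exact_mod_cast (card_le_card (erase_subset _ _)).trans (hA α)
    _ = D * ∑ α with e ∈ A α, W α := (mul_sum ..).symm
    _ ≤ D * K := mul_le_mul_of_nonneg_left (hK e) (Nat.cast_nonneg _)

lemma resampleAll_exp_field_le (hq0 : 0 ≤ q) (hq1 : q ≤ 1) (hW : ∀ α, 0 ≤ W α)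
    (hA : ∀ α, (A α).card ≤ D) (hη0 : 0 ≤ η)
    (hη : ∀ g h, g ≠ h → ∑ α with g ∈ A α ∧ h ∈ A α, W α ≤ η)
    (hK : ∀ g, ∑ α with g ∈ A α, W α ≤ K) (e : EdgeSet n) {s b : ℝ} (hs : |s| * η ≤ 1)
    (x : Config n) :
    resampleAll q univ.toList (fun y => Real.exp (s * field W A e y + b)) x ≤
      Real.exp (s * ∑ α with e ∈ A α, W α * q ^ ((A α).card - 1) + b +
        s ^ 2 * (η * (D * K))) := by
  have hc : ∀ g, ∑ α with e ∈ A α ∧ g ∈ (A α).erase e, W α ≤ η := by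
    intro g
    by_cases h : g = e
    · subst h; simpa using hη0
    · simpa [mem_erase, h] using hη e g (Ne.symm h)
  have hc0 : ∀ g, 0 ≤ ∑ α with e ∈ A α ∧ g ∈ (A α).erase e, W α :=
    fun g => sum_nonneg fun α _ => hW α
  refine (resampleAll_exp_le hq0 hq1 (field_hasInfluence hW e s b)
    (fun g => (mul_le_mul_of_nonneg_left (hc g) (abs_nonneg s)).trans hs) _ x).trans ?_
  rw [resampleAll_add_const, resampleAll_const_mul, resampleAll_univ_field]
  refine Real.exp_le_exp.mpr (add_le_add le_rfl ?_)
  rw [sum_map_toList]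
  simp only [mul_pow, sq_abs]
  rw [← mul_sum]
  refine mul_le_mul_of_nonneg_left ?_ (sq_nonneg s)
  calc ∑ g, (∑ α with e ∈ A α ∧ g ∈ (A α).erase e, W α) ^ 2
      ≤ ∑ g, η * ∑ α with e ∈ A α ∧ g ∈ (A α).erase e, W α :=
        sum_le_sum fun g _ => by
          rw [sq]
          exact mul_le_mul_of_nonneg_right (hc g) (hc0 g)
    _ = η * ∑ g, ∑ α with e ∈ A α ∧ g ∈ (A α).erase e, W α := (mul_sum ..).symm
    _ ≤ η * (D * K) := mul_le_mul_of_nonneg_left (sum_influence_le hW hA hK e) hη0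

lemma field_upper_tail {w : Config n → ℝ} (hw : IsFerromagnetic w (field W A))
    (hq0 : 0 ≤ q) (hq1 : q ≤ 1) (hW : ∀ α, 0 ≤ W α) (hA : ∀ α, (A α).card ≤ D) (hη0 : 0 ≤ η)
    (hη : ∀ g h, g ≠ h → ∑ α with g ∈ A α ∧ h ∈ A α, W α ≤ η)
    (hK : ∀ g, ∑ α with g ∈ A α, W α ≤ K) {δ : ℝ}
    (hδ : ∀ g, expect w (fun x => indic (q < Phi (field W A g x))) ≤ δ) (e : EdgeSet n)
    {m ε t : ℝ} (hm : ∑ α with e ∈ A α, W α * q ^ ((A α).card - 1) ≤ m) (ht : 0 ≤ t)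
    (htη : t * η ≤ 1) :
    expect w (fun x => indic (m + ε < field W A e x)) ≤
      Real.exp (t ^ 2 * (η * (D * K)) - t * ε) + Fintype.card (EdgeSet n) * δ := by
  refine (hw.expect_le_of_monotone hq0 hq1 hδ ?_ ?_).trans (add_le_add ?_ le_rfl)
  · intro x y h
    have := field_mono A hW e h
    simp only [indic]
    split_ifs <;> linarith
  · intro x
    unfold indic
    split_ifs <;> simp
  · refine (expect_mono hw.nonneg fun x => (resampleAll_mono hq0 hq1 _
      (f' := fun y => Real.exp (t * field W A e y + -(t * (m + ε)))) (fun y => ?_) x).trans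
      (resampleAll_exp_field_le hq0 hq1 hW hA hη0 hη hK e (by rwa [abs_of_nonneg ht]) x)).trans ?_
    · unfold indic
      split_ifs with h
      · exact Real.one_le_exp (by nlinarith)
      · exact (Real.exp_pos _).le
    · rw [expect_const hw.sum_eq_one]
      exact Real.exp_le_exp.mpr (by nlinarith)

lemma field_lower_tail {w : Config n → ℝ} (hw : IsFerromagnetic w (field W A))
    (hq0 : 0 ≤ q) (hq1 : q ≤ 1) (hW : ∀ α, 0 ≤ W α) (hA : ∀ α, (A α).card ≤ D) (hη0 : 0 ≤ η)
    (hη : ∀ g h, g ≠ h → ∑ α with g ∈ A α ∧ h ∈ A α, W α ≤ η)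
    (hK : ∀ g, ∑ α with g ∈ A α, W α ≤ K) {δ : ℝ}
    (hδ : ∀ g, expect w (fun x => indic (Phi (field W A g x) < q)) ≤ δ) (e : EdgeSet n)
    {m ε t : ℝ} (hm : m ≤ ∑ α with e ∈ A α, W α * q ^ ((A α).card - 1)) (ht : 0 ≤ t)
    (htη : t * η ≤ 1) :
    expect w (fun x => indic (field W A e x < m - ε)) ≤
      Real.exp (t ^ 2 * (η * (D * K)) - t * ε) + Fintype.card (EdgeSet n) * δ := by
  refine (hw.expect_le_of_antitone hq0 hq1 hδ ?_ ?_).trans (add_le_add ?_ le_rfl)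
  · intro x y h
    have := field_mono A hW e h
    simp only [indic]
    split_ifs <;> linarith
  · intro x
    unfold indic
    split_ifs <;> simp
  · refine (expect_mono hw.nonneg fun x => (resampleAll_mono hq0 hq1 _
      (f' := fun y => Real.exp (-t * field W A e y + t * (m - ε))) (fun y => ?_) x).trans
      (resampleAll_exp_field_le hq0 hq1 hW hA hη0 hη hK e
        (by rwa [abs_neg, abs_of_nonneg ht]) x)).trans ?_
    · unfold indic
      split_ifs with h
      · exact Real.one_le_exp (by nlinarith)
      · exact (Real.exp_pos _).le
    · rw [expect_const hw.sum_eq_one]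
      exact Real.exp_le_exp.mpr (by nlinarith)

end Field

end Product

/-! ### Relabelling the vertices -/

section Relabel

variable {n : ℕ}

/-- The action of a permutation of the vertices on the edges of the complete graph. -/
def edgePerm (σ : Equiv.Perm (Fin n)) : Equiv.Perm (EdgeSet n) where
  toFun e := ⟨Sym2.map σ e.1, fun h => e.2 ((Sym2.isDiag_map σ.injective).mp h)⟩
  invFun e := ⟨Sym2.map σ.symm e.1, fun h => e.2 ((Sym2.isDiag_map σ.symm.injective).mp h)⟩
  left_inv e := Subtype.ext (by simp [Sym2.map_map])
  right_inv e := Subtype.ext (by simp [Sym2.map_map])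

lemma coe_edgePerm (σ : Equiv.Perm (Fin n)) (e : EdgeSet n) :
    (edgePerm σ e).1 = Sym2.map σ e.1 := rfl

/-- The edge joining two distinct vertices. -/
def edge {a b : Fin n} (h : a ≠ b) : EdgeSet n := ⟨s(a, b), h⟩

lemma exists_eq_edge (e : EdgeSet n) : ∃ (a b : Fin n) (h : a ≠ b), e = edge h := by
  obtain ⟨z, hz⟩ := e
  induction z with
  | _ a b => exact ⟨a, b, hz, rfl⟩

lemma edge_congr {a b c d : Fin n} {h : a ≠ b} {h' : c ≠ d} (hac : a = c) (hbd : b = d) :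
    edge h = edge h' := Subtype.ext (by simp [edge, hac, hbd])

lemma exists_perm_apply_eq {k : ℕ} (x y : Fin k ↪ Fin n) :
    ∃ σ : Equiv.Perm (Fin n), ∀ i, σ (x i) = y i := by
  have := Equiv.Perm.isMultiplyPretransitive (Fin n) k
  obtain ⟨σ, hσ⟩ := MulAction.exists_smul_eq (Equiv.Perm (Fin n)) x y
  exact ⟨σ, fun i => by rw [← hσ]; rfl⟩

lemma exists_edgePerm_eq (e e' : EdgeSet n) : ∃ σ, edgePerm σ e = e' := by
  obtain ⟨a, b, h, rfl⟩ := exists_eq_edge e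
  obtain ⟨a', b', h', rfl⟩ := exists_eq_edge e'
  obtain ⟨σ, hσ⟩ := exists_perm_apply_eq (k := 2)
    ⟨![a, b], by intro i j; fin_cases i <;> fin_cases j <;> simp [h, h.symm]⟩
    ⟨![a', b'], by intro i j; fin_cases i <;> fin_cases j <;> simp [h', h'.symm]⟩
  exact ⟨σ, edge_congr (hσ 0) (hσ 1)⟩

lemma card_edgeSet (n : ℕ) : (Fintype.card (EdgeSet n) : ℝ) = n * (n - 1) / 2 := by
  rw [Sym2.card_subtype_not_diag, Fintype.card_fin, Nat.cast_choose_two]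

/-- A kernel on pairs of edges that does not depend on the labels of the vertices. -/
def IsSymmetricKernel (F : EdgeSet n → EdgeSet n → ℝ) : Prop :=
  ∀ σ e g, F (edgePerm σ e) (edgePerm σ g) = F e g

lemma IsSymmetricKernel.le_of_share {F : EdgeSet n → EdgeSet n → ℝ} (hF : IsSymmetricKernel F)
    (hF0 : ∀ e g, 0 ≤ F e g) {C : ℝ} (hC : ∀ e, ∑ g, F e g ≤ C) (hn : 4 ≤ n)
    {e g : EdgeSet n} (heg : e ≠ g) (hs : ShareVertex e g) : F e g ≤ 2 * C / n := by
  obtain ⟨u, v, w, huv, huw, hvw, rfl, rfl⟩ : ∃ (u v w : Fin n) (huv : u ≠ v) (huw : u ≠ w),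
      ∃ (_ : v ≠ w), e = edge huv ∧ g = edge huw := by
    obtain ⟨u, hue, hug⟩ := hs
    obtain ⟨v, hv⟩ := hue
    obtain ⟨w, hw⟩ := hug
    have huv : u ≠ v := fun h => e.2 (by rw [hv, h]; rfl)
    have huw : u ≠ w := fun h => g.2 (by rw [hw, h]; rfl)
    refine ⟨u, v, w, huv, huw, ?_, Subtype.ext hv, Subtype.ext hw⟩
    rintro rfl
    exact heg (Subtype.ext (hv.trans hw.symm))
  have heq : ∀ w' (h1 : u ≠ w'), v ≠ w' → F (edge huv) (edge h1) = F (edge huv) (edge huw) := by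
    intro w' h1 h2
    obtain ⟨σ, hσ⟩ := exists_perm_apply_eq (k := 3)
      ⟨![u, v, w], by
        intro i j
        fin_cases i <;> fin_cases j <;>
          simp [huv, huw, hvw, huv.symm, huw.symm, hvw.symm]⟩
      ⟨![u, v, w'], by
        intro i j; fin_cases i <;> fin_cases j <;> simp [huv, h1, h2, huv.symm, h1.symm, h2.symm]⟩
    have e1 : edgePerm σ (edge huv) = edge huv := edge_congr (hσ 0) (hσ 1)
    have e2 : edgePerm σ (edge huw) = edge h1 := edge_congr (hσ 0) (hσ 2)
    rw [← hF σ (edge huv) (edge huw), e1, e2]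
  set S : Finset (Fin n) := univ \ {u, v} with hS
  have hmem : ∀ x : S, u ≠ x.1 ∧ v ≠ x.1 := fun x => by
    have := x.2
    simp only [hS, Finset.mem_sdiff, mem_univ, true_and, mem_insert, mem_singleton, not_or] at this
    exact ⟨Ne.symm this.1, Ne.symm this.2⟩
  have hcard : (n : ℝ) - 2 = Fintype.card S := by
    rw [Fintype.card_coe, hS, card_sdiff_of_subset (subset_univ _), card_univ, Fintype.card_fin,
      card_pair huv, Nat.cast_sub (by omega)]
    norm_num
  have hinj : Function.Injective fun x : S => edge (hmem x).1 := by
    intro x y h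
    have := congrArg Subtype.val h
    simp only [edge, Sym2.eq_iff] at this
    rcases this with ⟨-, h⟩ | ⟨h, h'⟩
    · exact Subtype.ext h
    · exact absurd h (hmem y).1
  have hsum : ((n : ℝ) - 2) * F (edge huv) (edge huw) ≤ C := by
    refine le_trans ?_ (hC (edge huv))
    rw [hcard, ← nsmul_eq_mul, ← card_univ, ← sum_const]
    calc ∑ x : S, F (edge huv) (edge huw) = ∑ x : S, F (edge huv) (edge (hmem x).1) :=
          sum_congr rfl fun x _ => (heq x.1 (hmem x).1 (hmem x).2).symm
      _ = ∑ g ∈ univ.map ⟨_, hinj⟩, F (edge huv) g := by rw [sum_map]; rfl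
      _ ≤ _ := sum_le_sum_of_subset_of_nonneg (subset_univ _) fun g _ _ => hF0 _ g
  have hn' : (4 : ℝ) ≤ n := by exact_mod_cast hn
  rw [le_div_iff₀ (by linarith)]
  nlinarith [hF0 (edge huv) (edge huw)]

lemma card_shareVertex_le (e : EdgeSet n) [DecidablePred (ShareVertex e)] :
    (univ.filter (ShareVertex e)).card ≤ 2 * n := by
  obtain ⟨u, v, huv, rfl⟩ := exists_eq_edge e
  have hsub : (univ.filter (ShareVertex (edge huv))).map (Function.Embedding.subtype _) ⊆
      univ.image (fun a : Fin n => s(u, a)) ∪ univ.image (fun a : Fin n => s(v, a)) := by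
    intro z hz
    obtain ⟨g, hg, rfl⟩ := mem_map.mp hz
    obtain ⟨x, hx, ⟨y, hy⟩⟩ := (mem_filter.mp hg).2
    rcases Sym2.mem_iff.mp hx with rfl | rfl
    · exact mem_union_left _ (mem_image.mpr ⟨y, mem_univ _, hy.symm⟩)
    · exact mem_union_right _ (mem_image.mpr ⟨y, mem_univ _, hy.symm⟩)
  have h := (card_le_card hsub).trans (card_union_le _ _)
  have h1 := card_image_le (s := univ) (f := fun a : Fin n => s(u, a))
  have h2 := card_image_le (s := univ) (f := fun a : Fin n => s(v, a))
  rw [card_map] at h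
  simp only [card_univ, Fintype.card_fin] at h1 h2
  omega

lemma IsSymmetricKernel.le_of_not_share {F : EdgeSet n → EdgeSet n → ℝ}
    (hF : IsSymmetricKernel F) (hF0 : ∀ e g, 0 ≤ F e g) {C : ℝ} (hC : ∀ e, ∑ g, F e g ≤ C)
    (hn : 10 ≤ n) {e g : EdgeSet n} (hs : ¬ ShareVertex e g) : F e g ≤ 4 * C / (n : ℝ) ^ 2 := by
  classical
  have heq : ∀ g', ¬ ShareVertex e g' → F e g' = F e g := by
    intro g' hs'
    obtain ⟨u, v, huv, rfl⟩ := exists_eq_edge e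
    obtain ⟨a, b, hab, rfl⟩ := exists_eq_edge g
    obtain ⟨a', b', hab', rfl⟩ := exists_eq_edge g'
    have hd : ∀ {a b : Fin n} (h : a ≠ b), ¬ ShareVertex (edge huv) (edge h) →
        u ≠ a ∧ u ≠ b ∧ v ≠ a ∧ v ≠ b := by
      intro a b h hs
      exact ⟨fun h0 => hs ⟨u, Sym2.mem_mk_left _ _, h0 ▸ Sym2.mem_mk_left _ _⟩,
        fun h0 => hs ⟨u, Sym2.mem_mk_left _ _, h0 ▸ Sym2.mem_mk_right _ _⟩,
        fun h0 => hs ⟨v, Sym2.mem_mk_right _ _, h0 ▸ Sym2.mem_mk_left _ _⟩,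
        fun h0 => hs ⟨v, Sym2.mem_mk_right _ _, h0 ▸ Sym2.mem_mk_right _ _⟩⟩
    obtain ⟨h1, h2, h3, h4⟩ := hd hab hs
    obtain ⟨k1, k2, k3, k4⟩ := hd hab' hs'
    obtain ⟨σ, hσ⟩ := exists_perm_apply_eq (k := 4)
      ⟨![u, v, a, b], by
        intro i j
        fin_cases i <;> fin_cases j <;>
          simp [huv, hab, h1, h2, h3, h4, huv.symm, hab.symm, h1.symm, h2.symm, h3.symm, h4.symm]⟩
      ⟨![u, v, a', b'], by
        intro i j
        fin_cases i <;> fin_cases j <;>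
          simp [huv, hab', k1, k2, k3, k4, huv.symm, hab'.symm, k1.symm, k2.symm, k3.symm, k4.symm]⟩
    have e1 : edgePerm σ (edge huv) = edge huv := edge_congr (hσ 0) (hσ 1)
    have e2 : edgePerm σ (edge hab) = edge hab' := edge_congr (hσ 2) (hσ 3)
    rw [← hF σ (edge huv) (edge hab), e1, e2]
  have hsum : ((univ.filter fun g' => ¬ ShareVertex e g').card : ℝ) * F e g ≤ C := by
    refine le_trans ?_ (hC e)
    rw [← nsmul_eq_mul, ← sum_const]
    calc ∑ g' with ¬ ShareVertex e g', F e g = ∑ g' with ¬ ShareVertex e g', F e g' :=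
          sum_congr rfl fun g' hg' => (heq g' (mem_filter.mp hg').2).symm
      _ ≤ _ := sum_le_sum_of_subset_of_nonneg (subset_univ _) fun g _ _ => hF0 _ g
  have hcard : (Fintype.card (EdgeSet n) : ℝ) - 2 * n ≤
      (univ.filter fun g' => ¬ ShareVertex e g').card := by
    have h1 := card_filter_add_card_filter_not (s := univ) (ShareVertex e)
    have h2 := card_shareVertex_le e
    rw [card_univ] at h1
    rw [← h1]
    have h2' : ((univ.filter (ShareVertex e)).card : ℝ) ≤ 2 * n := by exact_mod_cast h2
    push_cast
    linarith
  rw [card_edgeSet] at hcard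
  have hn' : (10 : ℝ) ≤ n := by exact_mod_cast hn
  rw [le_div_iff₀ (by positivity)]
  have h0 := hF0 e g
  have h5 : (n : ℝ) ^ 2 / 4 ≤ (univ.filter fun g' => ¬ ShareVertex e g').card := by nlinarith
  nlinarith

end Relabel

/-! ### The Hamiltonian as a polynomial in the edge indicators -/

section Copies

variable {n m : ℕ}

open scoped Classical in
/-- The edges of the copy of `G` placed at `ψ`. -/
noncomputable def copyEdges (G : SimpleGraph (Fin m)) (ψ : Fin m ↪ Fin n) :
    Finset (EdgeSet n) := univ.filter fun e => e.1 ∈ Sym2.map ψ '' G.edgeSet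

lemma mem_copyEdges {G : SimpleGraph (Fin m)} {ψ : Fin m ↪ Fin n} {e : EdgeSet n} :
    e ∈ copyEdges G ψ ↔ e.1 ∈ Sym2.map ψ '' G.edgeSet := by
  simp [copyEdges]

lemma card_copyEdges (G : SimpleGraph (Fin m)) (ψ : Fin m ↪ Fin n) :
    (copyEdges G ψ).card = numEdges G := by
  rw [numEdges, ← Set.ncard_image_of_injective G.edgeSet (Sym2.map.injective ψ.injective),
    ← Set.ncard_coe_finset, ← Set.ncard_image_of_injective _ Subtype.val_injective]
  congr 1
  ext z
  constructor
  · rintro ⟨e, he, rfl⟩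
    exact mem_copyEdges.mp he
  · intro hz
    have hd : ¬ z.IsDiag := by
      obtain ⟨y, hy, rfl⟩ := hz
      rw [Sym2.isDiag_map ψ.injective]
      exact G.not_isDiag_of_mem_edgeSet hy
    exact ⟨⟨z, hd⟩, mem_copyEdges.mpr hz, rfl⟩

lemma edgePerm_mem_copyEdges {G : SimpleGraph (Fin m)} {ψ : Fin m ↪ Fin n} {e : EdgeSet n}
    (σ : Equiv.Perm (Fin n)) :
    edgePerm σ e ∈ copyEdges G (ψ.trans σ.toEmbedding) ↔ e ∈ copyEdges G ψ := by
  rw [mem_copyEdges, mem_copyEdges, coe_edgePerm]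
  have h : ∀ z, Sym2.map (ψ.trans σ.toEmbedding) z = Sym2.map σ (Sym2.map ψ z) := fun z => by
    rw [Sym2.map_map]; rfl
  simp only [Set.mem_image, h, (Sym2.map.injective σ.injective).eq_iff]

lemma edgeInd_eq_edgeX (x : Config n) {a b : Fin n} (h : a ≠ b) :
    edgeInd x a b = edgeX (edge h) x := by
  have hd : ¬ (s(a, b) : Sym2 (Fin n)).IsDiag := h
  simp only [edgeInd, edgeVal, edgeX, edge, dif_neg hd]
  rfl

lemma NG_eq_sum_mon (G : SimpleGraph (Fin m)) (x : Config n) :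
    NG G x = ∑ ψ : Fin m ↪ Fin n, mon (copyEdges G ψ) x := by
  classical
  refine sum_congr rfl fun ψ _ => ?_
  rw [mon_eq_ite]
  split_ifs with h
  · refine prod_eq_one fun a _ => prod_eq_one fun b _ => ?_
    split_ifs with hab
    · have hne := ψ.injective.ne hab.ne
      rw [edgeInd_eq_edgeX x hne, edgeX, if_pos]
      exact h _ (mem_copyEdges.mpr ⟨s(a, b), hab, rfl⟩)
    · rfl
  · push Not at h
    obtain ⟨e, he, hx⟩ := h
    obtain ⟨z, hz, hze⟩ := mem_copyEdges.mp he
    induction z with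
    | _ a b =>
      have hab : G.Adj a b := hz
      have hne := ψ.injective.ne hab.ne
      refine prod_eq_zero (mem_univ a) (prod_eq_zero (mem_univ b) ?_)
      have heq : edge hne = e := Subtype.ext hze
      rw [if_pos hab, edgeInd_eq_edgeX x hne, heq, edgeX, if_neg hx]

/-- Postcomposition with a permutation of the vertices. -/
def embPerm (σ : Equiv.Perm (Fin n)) : Equiv.Perm (Fin m ↪ Fin n) :=
  Equiv.embeddingCongr (Equiv.refl _) σ

lemma embPerm_apply (σ : Equiv.Perm (Fin n)) (ψ : Fin m ↪ Fin n) :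
    embPerm σ ψ = ψ.trans σ.toEmbedding := by
  ext i; rfl

/-- Number of placements of `G` using the edge `e`. -/
noncomputable def copyCount (G : SimpleGraph (Fin m)) (e : EdgeSet n) : ℕ :=
  (univ.filter fun ψ : Fin m ↪ Fin n => e ∈ copyEdges G ψ).card

lemma copyCount_edgePerm (G : SimpleGraph (Fin m)) (σ : Equiv.Perm (Fin n)) (e : EdgeSet n) :
    copyCount G (edgePerm σ e) = copyCount G e := by
  unfold copyCount
  symm
  refine card_bij (fun ψ _ => embPerm σ ψ) (fun ψ hψ => ?_)
    (fun _ _ _ _ h => (embPerm σ).injective h)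
    fun ψ hψ => ⟨(embPerm σ).symm ψ, ?_, (embPerm σ).apply_symm_apply ψ⟩
  · simpa [embPerm_apply, edgePerm_mem_copyEdges] using hψ
  · obtain ⟨ψ, rfl⟩ := (embPerm σ).surjective ψ
    rw [Equiv.symm_apply_apply]
    simpa [embPerm_apply, edgePerm_mem_copyEdges] using hψ

lemma card_mul_copyCount (G : SimpleGraph (Fin m)) (e : EdgeSet n) :
    Fintype.card (EdgeSet n) * copyCount G e = n.descFactorial m * numEdges G := by
  have h1 : ∀ g, copyCount G g = copyCount G e := fun g => by
    obtain ⟨σ, rfl⟩ := exists_edgePerm_eq e g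
    exact copyCount_edgePerm G σ e
  have h2 : ∑ g : EdgeSet n, copyCount G g = Fintype.card (EdgeSet n) * copyCount G e := by
    simp [h1]
  rw [← h2]
  simp only [copyCount, card_filter]
  rw [sum_comm]
  simp [card_copyEdges, Fintype.card_embedding_eq]

lemma two_le_of_numEdges_pos {G : SimpleGraph (Fin m)} (h : 0 < numEdges G) : 2 ≤ m := by
  have hne : G.edgeSet.Nonempty := Set.nonempty_of_ncard_ne_zero h.ne'
  obtain ⟨z, hz⟩ := hne
  induction z with
  | _ a b =>
    have hab : G.Adj a b := hz
    have := hab.ne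
    have ha := a.2
    have hb := b.2
    by_contra! hm
    exact this (Fin.ext (by omega))

/-- The normalised number of placements through an edge. -/
lemma copyCount_div_eq (G : SimpleGraph (Fin m)) (hG : 0 < numEdges G) (hn : 2 ≤ n)
    (e : EdgeSet n) :
    (copyCount G e : ℝ) / n ^ (m - 2) =
      2 * numEdges G * (n.descFactorial m / n ^ m) * (n / (n - 1)) := by
  have hm := two_le_of_numEdges_pos hG
  have hn' : (2 : ℝ) ≤ n := by exact_mod_cast hn
  have h := congrArg (Nat.cast : ℕ → ℝ) (card_mul_copyCount G e)
  push_cast at h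
  rw [card_edgeSet] at h
  have hpow : (n : ℝ) ^ m = n ^ (m - 2) * n ^ 2 := by rw [← pow_add]; congr 1; omega
  have h1 : (n : ℝ) - 1 ≠ 0 := by linarith
  have h2 : (n : ℝ) ≠ 0 := by linarith
  have hc : (copyCount G e : ℝ) = n.descFactorial m * numEdges G * 2 / (n * (n - 1)) := by
    rw [eq_div_iff (mul_ne_zero h2 h1)]
    linarith
  rw [hc, hpow]
  field_simp

lemma descFactorial_mul_le (hm : 2 ≤ m) (n : ℕ) :
    n.descFactorial m ≤ n * (n - 1) * n ^ (m - 2) := by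
  obtain ⟨k, rfl⟩ := Nat.exists_eq_add_of_le' hm
  induction k with
  | zero => simp [Nat.descFactorial_succ, mul_comm]
  | succ k ih =>
    rw [show k + 1 + 2 = (k + 2) + 1 from rfl, Nat.descFactorial_succ]
    calc (n - (k + 2)) * n.descFactorial (k + 2) ≤ n * (n * (n - 1) * n ^ (k + 2 - 2)) :=
          Nat.mul_le_mul (Nat.sub_le _ _) (ih (by omega))
      _ = _ := by
        rw [show k + 2 + 1 - 2 = (k + 2 - 2) + 1 by omega, pow_succ]
        ring

lemma copyCount_div_le (G : SimpleGraph (Fin m)) (hn : 2 ≤ n) (e : EdgeSet n) :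
    (copyCount G e : ℝ) / n ^ (m - 2) ≤ 2 * numEdges G := by
  have hn' : (2 : ℝ) ≤ n := by exact_mod_cast hn
  rcases Nat.eq_zero_or_pos (numEdges G) with h0 | hG
  · have h := card_mul_copyCount G e
    rw [h0, mul_zero, mul_eq_zero, or_iff_right (Fintype.card_pos_iff.mpr ⟨e⟩).ne'] at h
    simp [h, h0]
  · rw [copyCount_div_eq G hG hn, mul_assoc]
    refine mul_le_of_le_one_right (by positivity) ?_
    have hm := two_le_of_numEdges_pos hG
    have h := (Nat.cast_le (α := ℝ)).mpr (descFactorial_mul_le hm n)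
    push_cast [Nat.cast_sub (show 1 ≤ n by omega)] at h
    have hpow : (n : ℝ) ^ m = n ^ (m - 2) * n ^ 2 := by rw [← pow_add]; congr 1; omega
    have h1 : (0 : ℝ) < n - 1 := by linarith
    rw [div_mul_div_comm, div_le_one (by positivity), hpow]
    nlinarith

lemma tendsto_descFactorial_div_pow (m : ℕ) :
    Tendsto (fun n : ℕ => (n.descFactorial m : ℝ) / n ^ m) atTop (nhds 1) := by
  have hlow : Tendsto (fun n : ℕ => (1 - (m : ℝ) / n) ^ m) atTop (nhds 1) := by
    have := (tendsto_const_nhds (x := (1 : ℝ))).sub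
      (tendsto_const_div_atTop_nhds_zero_nat (m : ℝ))
    simpa using this.pow m
  refine tendsto_of_tendsto_of_tendsto_of_le_of_le' hlow tendsto_const_nhds ?_ ?_
  · filter_upwards [eventually_ge_atTop (m + 1)] with n hn
    have hn0 : (0 : ℝ) < n := by exact_mod_cast (show 0 < n by omega)
    have h := (Nat.cast_le (α := ℝ)).mpr (Nat.pow_sub_le_descFactorial n m)
    push_cast [Nat.cast_sub (show m ≤ n + 1 by omega)] at h
    rw [le_div_iff₀ (by positivity), ← mul_pow]
    refine le_trans (pow_le_pow_left₀ ?_ ?_ m) h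
    · have : (m : ℝ) ≤ n := by exact_mod_cast (show m ≤ n by omega)
      have h1 : (m : ℝ) / n ≤ 1 := (div_le_one hn0).mpr this
      exact mul_nonneg (by linarith) hn0.le
    · rw [sub_mul, div_mul_cancel₀ _ hn0.ne']
      linarith
  · filter_upwards [eventually_ge_atTop 1] with n hn
    have hn0 : (0 : ℝ) < n := by exact_mod_cast hn
    rw [div_le_one (by positivity)]
    exact_mod_cast Nat.descFactorial_le_pow n m

lemma eventually_le_copyCount_div (G : SimpleGraph (Fin m)) {θ : ℝ} (hθ : θ < 1) :
    ∀ᶠ n : ℕ in atTop, ∀ e : EdgeSet n,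
      2 * numEdges G * θ ≤ (copyCount G e : ℝ) / n ^ (m - 2) := by
  rcases Nat.eq_zero_or_pos (numEdges G) with h0 | hG
  · refine Eventually.of_forall fun n e => ?_
    rw [h0]
    simp only [Nat.cast_zero, mul_zero, zero_mul]
    positivity
  · filter_upwards [(tendsto_descFactorial_div_pow m).eventually_const_lt hθ,
      eventually_ge_atTop 2] with n h hn e
    rw [copyCount_div_eq G hG hn]
    refine (mul_le_mul_of_nonneg_left ?_ (by positivity)).trans_eq (mul_assoc _ _ _).symm
    have hn' : (2 : ℝ) ≤ n := by exact_mod_cast hn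
    have h1 : (1 : ℝ) ≤ n / (n - 1) := by
      rw [le_div_iff₀ (by linarith)]; linarith
    have h2 : (0 : ℝ) ≤ n.descFactorial m / n ^ m := by positivity
    nlinarith

end Copies

section Model

variable {n s : ℕ} {V : Fin s → ℕ}

/-- All placements of the graphs of the model. -/
abbrev Placement (V : Fin s → ℕ) (n : ℕ) : Type := Σ i : Fin s, (Fin (V i) ↪ Fin n)

/-- The coefficient of a placement in the Hamiltonian. -/
noncomputable def weight (β : Fin s → ℝ) (α : Placement V n) : ℝ := β α.1 / n ^ (V α.1 - 2)

/-- The edges used by a placement. -/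
noncomputable def placed (G : ∀ i, SimpleGraph (Fin (V i))) (α : Placement V n) :
    Finset (EdgeSet n) := copyEdges (G α.1) α.2

variable {β : Fin s → ℝ} (G : ∀ i, SimpleGraph (Fin (V i)))

lemma weight_nonneg (hβ : ∀ i, 0 < β i) (α : Placement V n) : 0 ≤ weight β α :=
  div_nonneg (hβ _).le (by positivity)

lemma Hamiltonian_eq_energy (x : Config n) :
    Hamiltonian V G β x = energy (weight β) (placed G) x := by
  rw [Hamiltonian, energy, Fintype.sum_sigma]
  refine sum_congr rfl fun i _ => ?_
  rw [NG_eq_sum_mon, mul_div_right_comm, mul_sum]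
  rfl

lemma ergmProb_eq_gibbs : ergmProb (n := n) V G β = gibbs (weight β) (placed G) := by
  funext x
  simp only [ergmProb, gibbs, Hamiltonian_eq_energy]

lemma card_placed (α : Placement V n) : (placed G α).card = numEdges (G α.1) :=
  card_copyEdges _ _

lemma card_placed_le (α : Placement V n) : (placed G α).card ≤ ∑ i, numEdges (G i) := by
  rw [card_placed]
  exact single_le_sum (f := fun i => numEdges (G i)) (fun _ _ => Nat.zero_le _) (mem_univ _)

lemma sum_weight_mul (c : Fin s → ℝ) (e : EdgeSet n) :
    ∑ α with e ∈ placed G α, weight β α * c α.1 =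
      ∑ i, β i * c i * (copyCount (G i) e / n ^ (V i - 2)) := by
  rw [sum_filter, Fintype.sum_sigma]
  refine sum_congr rfl fun i _ => ?_
  rw [copyCount, card_filter, Nat.cast_sum, sum_div, mul_sum]
  refine sum_congr rfl fun ψ _ => ?_
  by_cases h : e ∈ copyEdges (G i) ψ
  · simp only [placed, weight, h, if_true]
    push_cast; ring
  · simp [placed, h]

lemma sum_weight_mul_le (hβ : ∀ i, 0 < β i) (hn : 2 ≤ n) {c : Fin s → ℝ} (hc : ∀ i, 0 ≤ c i)
    (e : EdgeSet n) :
    ∑ α with e ∈ placed G α, weight β α * c α.1 ≤ ∑ i, 2 * β i * numEdges (G i) * c i := by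
  rw [sum_weight_mul]
  refine sum_le_sum fun i _ => ?_
  have := mul_le_mul_of_nonneg_left (copyCount_div_le (G i) hn e)
    (mul_nonneg (hβ i).le (hc i))
  linarith

lemma sum_weight_le (hβ : ∀ i, 0 < β i) (hn : 2 ≤ n) (e : EdgeSet n) :
    ∑ α with e ∈ placed G α, weight β α ≤ ∑ i, 2 * β i * numEdges (G i) := by
  simpa using sum_weight_mul_le G hβ hn (c := fun _ => 1) (fun _ => zero_le_one) e

lemma eventually_le_sum_weight_mul (hβ : ∀ i, 0 < β i) {c : Fin s → ℝ} (hc : ∀ i, 0 ≤ c i)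
    {a : ℝ} (ha : a < ∑ i, 2 * β i * numEdges (G i) * c i) :
    ∀ᶠ n : ℕ in atTop, ∀ e : EdgeSet n,
      a ≤ ∑ α with e ∈ placed G α, weight β α * c α.1 := by
  set S := ∑ i, 2 * β i * numEdges (G i) * c i with hS
  have hS0 : 0 ≤ S := sum_nonneg fun i _ =>
    mul_nonneg (mul_nonneg (mul_nonneg zero_le_two (hβ i).le) (Nat.cast_nonneg _)) (hc i)
  obtain ⟨θ, hθ, hθS⟩ : ∃ θ < 1, a ≤ θ * S := by
    rcases hS0.eq_or_lt with h | h
    · exact ⟨0, zero_lt_one, by rw [zero_mul]; linarith⟩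
    · exact ⟨a / S, (div_lt_one h).mpr ha, (div_mul_cancel₀ a h.ne').ge⟩
  filter_upwards [eventually_all.mpr fun i => eventually_le_copyCount_div (G i) hθ] with n hn e
  refine hθS.trans ?_
  rw [sum_weight_mul, hS, mul_sum]
  refine sum_le_sum fun i _ => ?_
  have := mul_le_mul_of_nonneg_left (hn i e) (mul_nonneg (hβ i).le (hc i))
  linarith

/-- The action of a permutation of the vertices on placements. -/
def placementPerm (σ : Equiv.Perm (Fin n)) : Equiv.Perm (Placement V n) :=
  Equiv.sigmaCongrRight fun _ => embPerm σ

lemma edgePerm_mem_placed (σ : Equiv.Perm (Fin n)) (e : EdgeSet n) (α : Placement V n) :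
    edgePerm σ e ∈ placed G (placementPerm σ α) ↔ e ∈ placed G α :=
  edgePerm_mem_copyEdges σ

lemma energy_comp_edgePerm (σ : Equiv.Perm (Fin n)) (x : Config n) :
    energy (weight β) (placed G) (x ∘ edgePerm σ) = energy (weight β) (placed G) x := by
  rw [energy, energy,
    ← Equiv.sum_comp (placementPerm σ) fun α => weight β α * mon (placed G α) x]
  refine sum_congr rfl fun α _ => ?_
  congr 1
  exact prod_equiv (edgePerm σ) (fun g => (edgePerm_mem_placed G σ g α).symm) fun g _ => rfl

lemma gibbs_comp_edgePerm (σ : Equiv.Perm (Fin n)) (x : Config n) :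
    gibbs (weight β) (placed G) (x ∘ edgePerm σ) = gibbs (weight β) (placed G) x := by
  rw [gibbs, gibbs, energy_comp_edgePerm]

lemma expect_comp_edgePerm (σ : Equiv.Perm (Fin n)) (f : Config n → ℝ) :
    expect (gibbs (weight β) (placed G)) (fun x => f (x ∘ edgePerm σ)) =
      expect (gibbs (weight β) (placed G)) f := by
  unfold expect
  rw [← Equiv.sum_comp (Equiv.arrowCongr (edgePerm σ).symm (Equiv.refl Bool))
    fun x => gibbs (weight β) (placed G) x * f x]
  refine sum_congr rfl fun x _ => ?_
  rw [← gibbs_comp_edgePerm G σ]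
  rfl

lemma cov_isSymmetricKernel :
    IsSymmetricKernel fun e g : EdgeSet n =>
      cov (gibbs (weight β) (placed G)) (edgeX e) (edgeX g) := by
  intro σ e g
  dsimp only
  have h : ∀ e, expect (gibbs (weight β) (placed G)) (edgeX (edgePerm σ e)) =
      expect (gibbs (weight β) (placed G)) (edgeX e) := fun e =>
    expect_comp_edgePerm G σ (edgeX e)
  rw [cov, cov, h, h]
  exact expect_comp_edgePerm G σ fun x =>
    (edgeX e x - expect (gibbs (weight β) (placed G)) (edgeX e)) *
      (edgeX g x - expect (gibbs (weight β) (placed G)) (edgeX g))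

lemma pair_isSymmetricKernel :
    IsSymmetricKernel fun e g : EdgeSet n =>
      ∑ α with e ∈ placed G α ∧ g ∈ placed G α, weight β α := by
  intro σ e g
  dsimp only
  rw [sum_filter, sum_filter, ← Equiv.sum_comp (placementPerm σ)]
  simp only [edgePerm_mem_placed]
  rfl

lemma sum_weight_pair_le (hβ : ∀ i, 0 < β i) (hn : 10 ≤ n) {e g : EdgeSet n} (heg : e ≠ g) :
    ∑ α with e ∈ placed G α ∧ g ∈ placed G α, weight β α ≤
      2 * ((∑ i, numEdges (G i) : ℕ) * ∑ i, 2 * β i * numEdges (G i)) / n := by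
  set C := (∑ i, numEdges (G i) : ℕ) * ∑ i, 2 * β i * numEdges (G i) with hC
  have hF0 : ∀ e g : EdgeSet n, 0 ≤ ∑ α with e ∈ placed G α ∧ g ∈ placed G α, weight β α :=
    fun e g => sum_nonneg fun α _ => weight_nonneg hβ α
  have hsum : ∀ e : EdgeSet n,
      ∑ g, ∑ α with e ∈ placed G α ∧ g ∈ placed G α, weight β α ≤ C := by
    intro e
    simp only [← filter_filter, sum_filter (s := univ.filter fun α => e ∈ placed G α)]
    rw [sum_comm]
    calc ∑ α with e ∈ placed G α, ∑ g, (if g ∈ placed G α then weight β α else 0)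
        ≤ ∑ α with e ∈ placed G α, (∑ i, numEdges (G i) : ℕ) * weight β α := by
          refine sum_le_sum fun α _ => ?_
          rw [← sum_filter, sum_const, nsmul_eq_mul, filter_univ_mem]
          exact mul_le_mul_of_nonneg_right (by exact_mod_cast card_placed_le G α)
            (weight_nonneg hβ α)
      _ = (∑ i, numEdges (G i) : ℕ) * ∑ α with e ∈ placed G α, weight β α := (mul_sum ..).symm
      _ ≤ C := mul_le_mul_of_nonneg_left (sum_weight_le G hβ (by omega) e) (Nat.cast_nonneg _)
  by_cases hs : ShareVertex e g
  · exact (pair_isSymmetricKernel G).le_of_share hF0 hsum (by omega) heg hs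
  · refine ((pair_isSymmetricKernel G).le_of_not_share hF0 hsum hn hs).trans ?_
    have hC0 : 0 ≤ C := (sum_nonneg fun g _ => hF0 e g).trans (hsum e)
    have hn' : (10 : ℝ) ≤ n := by exact_mod_cast hn
    rw [div_le_div_iff₀ (by positivity) (by positivity)]
    nlinarith [mul_nonneg hC0 (Nat.cast_nonneg (α := ℝ) n),
      mul_nonneg (mul_nonneg hC0 (Nat.cast_nonneg (α := ℝ) n)) (sub_nonneg.mpr hn')]

end Model

/-! ### Concentration of the local fields -/

section Tails

lemma eventually_exp_sub_sqrt_le (c : ℝ) {ε : ℝ} (hε : 0 < ε) (k : ℕ) :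
    ∀ᶠ n : ℕ in atTop, Real.exp (c - ε * √n) ≤ 1 / (2 * n ^ k) := by
  have ht : Tendsto (fun n : ℕ => ε * √(n : ℝ)) atTop atTop :=
    (Real.tendsto_sqrt_atTop.comp tendsto_natCast_atTop_atTop).const_mul_atTop hε
  have h := (Real.tendsto_pow_mul_exp_neg_atTop_nhds_zero (2 * k)).comp ht
  have hpos : 0 < ε ^ (2 * k) * (Real.exp (-c) / 2) := by positivity
  filter_upwards [h.eventually_lt_const hpos, eventually_ge_atTop 1] with n hn h1
  have hn0 : (0 : ℝ) < n := by exact_mod_cast h1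
  simp only [Function.comp_apply, mul_pow, pow_mul, Real.sq_sqrt hn0.le] at hn
  rw [mul_assoc] at hn
  have h2 := lt_of_mul_lt_mul_left hn (by positivity)
  rw [le_div_iff₀ (by positivity), sub_eq_add_neg, Real.exp_add]
  have h3 := mul_lt_mul_of_pos_left h2 (Real.exp_pos c)
  have h4 : Real.exp c * (Real.exp (-c) / 2) = 1 / 2 := by
    rw [← mul_div_assoc, ← Real.exp_add, add_neg_cancel, Real.exp_zero]
  nlinarith

lemma eventually_tail_le (c b : ℝ) {ε : ℝ} (hε : 0 < ε) (k : ℕ) :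
    ∀ᶠ n : ℕ in atTop, √n * (c / n) ≤ 1 ∧
      Real.exp (√n ^ 2 * (c / n * b) - √n * ε) +
        Fintype.card (EdgeSet n) * (1 / (n : ℝ) ^ (k + 2)) ≤ 1 / (n : ℝ) ^ k := by
  have ht : Tendsto (fun n : ℕ => √(n : ℝ)) atTop atTop :=
    Real.tendsto_sqrt_atTop.comp tendsto_natCast_atTop_atTop
  filter_upwards [eventually_exp_sub_sqrt_le (c * b) hε k, ht.eventually_ge_atTop c,
    eventually_ge_atTop 1] with n h1 h2 h3
  have hn0 : (0 : ℝ) < n := by exact_mod_cast h3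
  have hs : √(n : ℝ) * √n = n := Real.mul_self_sqrt hn0.le
  constructor
  · rw [← mul_div_assoc, div_le_one hn0]
    nlinarith [Real.sqrt_nonneg (n : ℝ)]
  · have he : √(n : ℝ) ^ 2 * (c / n * b) - √n * ε = c * b - ε * √n := by
      rw [Real.sq_sqrt hn0.le]
      field_simp
    have hm : (n : ℝ) * (n - 1) / 2 * (1 / (n : ℝ) ^ (k + 2)) ≤ 1 / (2 * n ^ k) := by
      rw [mul_one_div, div_div, div_le_div_iff₀ (by positivity) (by positivity), pow_add]
      have : (0 : ℝ) < n ^ k := by positivity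
      nlinarith
    rw [he, card_edgeSet]
    have : (1 : ℝ) / (2 * n ^ k) + 1 / (2 * n ^ k) = 1 / n ^ k := by
      field_simp; norm_num
    linarith

variable {s : ℕ} {V : Fin s → ℕ} (G : ∀ i, SimpleGraph (Fin (V i))) (β : Fin s → ℝ)

/-- The field at an edge exceeds its mean under density `q` with negligible probability. -/
def UpperTail (q : ℝ) : Prop :=
  ∀ ε > 0, ∀ k : ℕ, ∀ᶠ n : ℕ in atTop, ∀ e : EdgeSet n,
    expect (gibbs (weight β) (placed G))
      (fun x => indic (Psi V G β q + ε < field (weight β) (placed G) e x)) ≤ 1 / (n : ℝ) ^ k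

/-- The field at an edge is below its mean under density `q` with negligible probability. -/
def LowerTail (q : ℝ) : Prop :=
  ∀ ε > 0, ∀ k : ℕ, ∀ᶠ n : ℕ in atTop, ∀ e : EdgeSet n,
    expect (gibbs (weight β) (placed G))
      (fun x => indic (field (weight β) (placed G) e x < Psi V G β q - ε)) ≤ 1 / (n : ℝ) ^ k

variable {β}

lemma upperTail_of_forall (hβ : ∀ i, 0 < β i) {q : ℝ} (hq0 : 0 ≤ q) (hq1 : q ≤ 1)
    (h : ∀ k : ℕ, ∀ᶠ n : ℕ in atTop, ∀ e : EdgeSet n, expect (gibbs (weight β) (placed G))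
      (fun x => indic (q < Phi (field (weight β) (placed G) e x))) ≤ 1 / (n : ℝ) ^ k) :
    UpperTail G β q := by
  intro ε hε k
  set D := ∑ i, numEdges (G i) with hD
  set K := ∑ i, 2 * β i * numEdges (G i) with hK
  have hK0 : 0 ≤ K := sum_nonneg fun i _ =>
    mul_nonneg (mul_nonneg zero_le_two (hβ i).le) (Nat.cast_nonneg _)
  filter_upwards [h (k + 2), eventually_tail_le (2 * (D * K)) (D * K) hε k,
    eventually_ge_atTop 10] with n h1 h2 hn e
  refine (field_upper_tail (gibbs_isFerromagnetic _ (weight_nonneg hβ)) hq0 hq1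
    (weight_nonneg hβ) (card_placed_le G) (by positivity)
    (fun g h hgh => sum_weight_pair_le G hβ hn hgh) (sum_weight_le G hβ (by omega)) h1 e
    (m := Psi V G β q) ?_ (Real.sqrt_nonneg n) h2.1).trans h2.2
  simp only [card_placed]
  exact sum_weight_mul_le G hβ (by omega) (c := fun i => q ^ (numEdges (G i) - 1))
    (fun i => pow_nonneg hq0 _) e

lemma lowerTail_of_forall (hβ : ∀ i, 0 < β i) {q : ℝ} (hq0 : 0 ≤ q) (hq1 : q ≤ 1)
    (h : ∀ k : ℕ, ∀ᶠ n : ℕ in atTop, ∀ e : EdgeSet n, expect (gibbs (weight β) (placed G))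
      (fun x => indic (Phi (field (weight β) (placed G) e x) < q)) ≤ 1 / (n : ℝ) ^ k) :
    LowerTail G β q := by
  intro ε hε k
  set D := ∑ i, numEdges (G i) with hD
  set K := ∑ i, 2 * β i * numEdges (G i) with hK
  have hK0 : 0 ≤ K := sum_nonneg fun i _ =>
    mul_nonneg (mul_nonneg zero_le_two (hβ i).le) (Nat.cast_nonneg _)
  filter_upwards [h (k + 2), eventually_tail_le (2 * (D * K)) (D * K) (half_pos hε) k,
    eventually_le_sum_weight_mul G hβ (c := fun i => q ^ (numEdges (G i) - 1))
      (fun i => pow_nonneg hq0 _) (sub_lt_self (Psi V G β q) (half_pos hε)),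
    eventually_ge_atTop 10] with n h1 h2 h3 hn e
  have := (field_lower_tail (gibbs_isFerromagnetic _ (weight_nonneg hβ)) hq0 hq1
    (weight_nonneg hβ) (card_placed_le G) (by positivity)
    (fun g h hgh => sum_weight_pair_le G hβ hn hgh) (sum_weight_le G hβ (by omega)) h1 e
    (m := Psi V G β q - ε / 2) (ε := ε / 2)
    (by simpa only [card_placed] using h3 e) (Real.sqrt_nonneg n) h2.1).trans h2.2
  rwa [sub_sub, add_halves] at this

lemma Phi_eq (u : ℝ) : Phi u = Real.sigmoid u := congrFun Phi_eq_sigmoid u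

lemma continuous_Phi : Continuous Phi := by
  rw [Phi_eq_sigmoid]; exact continuous_sigmoid

lemma continuous_Psi : Continuous (Psi V G β) := by
  unfold Psi; fun_prop

lemma Psi_mono (hβ : ∀ i, 0 < β i) {q q' : ℝ} (hq0 : 0 ≤ q) (h : q ≤ q') :
    Psi V G β q ≤ Psi V G β q' :=
  sum_le_sum fun i _ => mul_le_mul_of_nonneg_left (pow_le_pow_left₀ hq0 h _)
    (mul_nonneg (mul_nonneg zero_le_two (hβ i).le) (Nat.cast_nonneg _))

lemma indic_le {P Q : Prop} [Decidable P] [Decidable Q] (h : P → Q) : indic P ≤ indic Q := by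
  unfold indic
  split_ifs with h1 h2
  · exact le_rfl
  · exact absurd (h h1) h2
  · exact zero_le_one
  · exact le_rfl

lemma upperTail_step (hβ : ∀ i, 0 < β i) {q q' : ℝ} (hq : UpperTail G β q)
    (h : phiFn V G β q < q') (hq' : q' ≤ 1) : UpperTail G β q' := by
  have h0 : 0 ≤ q' := (Phi_nonneg _).trans h.le
  obtain ⟨ε, hε, hε'⟩ : ∃ ε > 0, Phi (Psi V G β q + ε) < q' := by
    have hc : ContinuousAt (fun ε => Phi (Psi V G β q + ε)) 0 :=
      (continuous_Phi.comp (continuous_const.add continuous_id)).continuousAt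
    have hev := (hc.eventually_lt_const (show Phi (Psi V G β q + 0) < q' by simpa [phiFn] using h))
    obtain ⟨ε, h1, h2⟩ := ((hev.filter_mono nhdsWithin_le_nhds).and
      (self_mem_nhdsWithin (a := (0 : ℝ)) (s := Set.Ioi 0))).exists
    exact ⟨ε, h2, h1⟩
  refine upperTail_of_forall G hβ h0 hq' fun k => ?_
  filter_upwards [hq ε hε k] with n hn e
  refine (expect_mono (gibbs_nonneg _ _) fun x => indic_le fun hx => ?_).trans (hn e)
  by_contra! hle
  exact absurd (Phi_monotone hle) (by linarith)

lemma lowerTail_step (hβ : ∀ i, 0 < β i) {q q' : ℝ} (hq : LowerTail G β q)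
    (h : q' < phiFn V G β q) (h0 : 0 ≤ q') : LowerTail G β q' := by
  have hq' : q' ≤ 1 := h.le.trans (Phi_le_one _)
  obtain ⟨ε, hε, hε'⟩ : ∃ ε > 0, q' < Phi (Psi V G β q - ε) := by
    have hc : ContinuousAt (fun ε => Phi (Psi V G β q - ε)) 0 :=
      (continuous_Phi.comp (continuous_const.sub continuous_id)).continuousAt
    have hev := (hc.eventually_const_lt (show q' < Phi (Psi V G β q - 0) by simpa [phiFn] using h))
    obtain ⟨ε, h1, h2⟩ := ((hev.filter_mono nhdsWithin_le_nhds).and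
      (self_mem_nhdsWithin (a := (0 : ℝ)) (s := Set.Ioi 0))).exists
    exact ⟨ε, h2, h1⟩
  refine lowerTail_of_forall G hβ h0 hq' fun k => ?_
  filter_upwards [hq ε hε k] with n hn e
  refine (expect_mono (gibbs_nonneg _ _) fun x => indic_le fun hx => ?_).trans (hn e)
  by_contra! hle
  exact absurd (Phi_monotone hle) (by linarith)

lemma upperTail_one (hβ : ∀ i, 0 < β i) : UpperTail G β 1 := by
  refine upperTail_of_forall G hβ zero_le_one le_rfl fun k => Eventually.of_forall fun n e => ?_
  have h : ∀ x : Config n, indic (1 < Phi (field (weight β) (placed G) e x)) = 0 := fun x =>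
    if_neg (not_lt.mpr (Phi_le_one _))
  simp only [h, expect, mul_zero, sum_const_zero]
  positivity

lemma lowerTail_zero (hβ : ∀ i, 0 < β i) : LowerTail G β 0 := by
  refine lowerTail_of_forall G hβ le_rfl zero_le_one fun k => Eventually.of_forall fun n e => ?_
  have h : ∀ x : Config n, indic (Phi (field (weight β) (placed G) e x) < 0) = 0 := fun x =>
    if_neg (not_lt.mpr (Phi_nonneg _))
  simp only [h, expect, mul_zero, sum_const_zero]
  positivity

variable {p : ℝ}

lemma continuous_phiFn : Continuous (phiFn V G β) := continuous_Phi.comp (continuous_Psi G)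

lemma phiFn_pos (q : ℝ) : 0 < phiFn V G β q := by
  rw [phiFn, Phi_eq]; exact Real.sigmoid_pos _

lemma phiFn_lt_one (q : ℝ) : phiFn V G β q < 1 := by
  rw [phiFn, Phi_eq]; exact Real.sigmoid_lt_one _

lemma phiFn_lt_self (huniq : ∀ q, phiFn V G β q = q → q = p) {q : ℝ} (hq : p < q)
    (hq1 : q ≤ 1) : phiFn V G β q < q := by
  by_contra! h
  obtain ⟨x, hx, hx0⟩ := intermediate_value_Icc' hq1
    (f := fun x => phiFn V G β x - x) ((continuous_phiFn G).sub continuous_id).continuousOn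
    ⟨(sub_neg.mpr (phiFn_lt_one G 1)).le, sub_nonneg.mpr h⟩
  have := huniq x (sub_eq_zero.mp hx0)
  linarith [hx.1]

lemma self_lt_phiFn (huniq : ∀ q, phiFn V G β q = q → q = p) {q : ℝ} (hq : q < p)
    (hq0 : 0 ≤ q) : q < phiFn V G β q := by
  by_contra! h
  obtain ⟨x, hx, hx0⟩ := intermediate_value_Icc' hq0
    (f := fun x => phiFn V G β x - x) ((continuous_phiFn G).sub continuous_id).continuousOn
    ⟨sub_nonpos.mpr h, by simpa using (phiFn_pos G 0).le⟩
  have := huniq x (sub_eq_zero.mp hx0)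
  linarith [hx.2]

lemma UpperTail.mono (hβ : ∀ i, 0 < β i) {q q' : ℝ} (hq : UpperTail G β q) (h0 : 0 ≤ q)
    (h : q ≤ q') : UpperTail G β q' := by
  intro ε hε k
  filter_upwards [hq ε hε k] with n hn e
  refine (expect_mono (gibbs_nonneg _ _) fun x => indic_le fun hx => ?_).trans (hn e)
  linarith [Psi_mono G hβ h0 h]

lemma LowerTail.mono (hβ : ∀ i, 0 < β i) {q q' : ℝ} (hq : LowerTail G β q) (h0 : 0 ≤ q')
    (h : q' ≤ q) : LowerTail G β q' := by
  intro ε hε k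
  filter_upwards [hq ε hε k] with n hn e
  refine (expect_mono (gibbs_nonneg _ _) fun x => indic_le fun hx => ?_).trans (hn e)
  linarith [Psi_mono G hβ h0 h]

lemma upperTail_of_lt (hβ : ∀ i, 0 < β i)
    (huniq : ∀ q, phiFn V G β q = q → q = p) {q : ℝ} (hq : p < q) : UpperTail G β q := by
  set S : Set ℝ := {q | 0 ≤ q ∧ q ≤ 1 ∧ UpperTail G β q} with hS
  have h1 : (1 : ℝ) ∈ S := ⟨zero_le_one, le_rfl, upperTail_one G hβ⟩
  have hbdd : BddBelow S := ⟨0, fun x hx => hx.1⟩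
  have hinf : sInf S ≤ p := by
    by_contra! hlt
    have hle1 : sInf S ≤ 1 := csInf_le hbdd h1
    have hlt' := phiFn_lt_self G huniq hlt hle1
    have hev := (continuous_phiFn (β := β) G).continuousAt.eventually_lt_const hlt'
    obtain ⟨r, hr, hball⟩ := Metric.eventually_nhds_iff.mp hev
    obtain ⟨x, hx, hxr⟩ := exists_lt_of_csInf_lt ⟨1, h1⟩ (lt_add_of_pos_right (sInf S) hr)
    have hxle := csInf_le hbdd hx
    have hφ : phiFn V G β x < sInf S := hball (by
      rw [Real.dist_eq, abs_of_nonneg (by linarith)]; linarith)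
    obtain ⟨y, hy1, hy2⟩ := exists_between hφ
    have hy : y ∈ S := ⟨(phiFn_pos G x).le.trans hy1.le, hy2.le.trans hle1,
      upperTail_step G hβ hx.2.2 hy1 (hy2.le.trans hle1)⟩
    exact absurd (csInf_le hbdd hy) (by linarith)
  obtain ⟨x, hx, hxq⟩ := exists_lt_of_csInf_lt ⟨1, h1⟩ (hinf.trans_lt hq)
  exact hx.2.2.mono G hβ hx.1 hxq.le

lemma lowerTail_of_lt (hβ : ∀ i, 0 < β i)
    (huniq : ∀ q, phiFn V G β q = q → q = p) {q : ℝ} (hq0 : 0 ≤ q) (hq : q < p) :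
    LowerTail G β q := by
  set S : Set ℝ := {q | 0 ≤ q ∧ q ≤ 1 ∧ LowerTail G β q} with hS
  have h1 : (0 : ℝ) ∈ S := ⟨le_rfl, zero_le_one, lowerTail_zero G hβ⟩
  have hbdd : BddAbove S := ⟨1, fun x hx => hx.2.1⟩
  have hsup : p ≤ sSup S := by
    by_contra! hlt
    have hle0 : 0 ≤ sSup S := le_csSup hbdd h1
    have hlt' := self_lt_phiFn G huniq hlt hle0
    have hev := (continuous_phiFn (β := β) G).continuousAt.eventually_const_lt hlt'
    obtain ⟨r, hr, hball⟩ := Metric.eventually_nhds_iff.mp hev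
    obtain ⟨x, hx, hxr⟩ := exists_lt_of_lt_csSup ⟨0, h1⟩ (sub_lt_self (sSup S) hr)
    have hxle := le_csSup hbdd hx
    have hφ : sSup S < phiFn V G β x := hball (by
      rw [Real.dist_eq, abs_of_nonpos (by linarith)]; linarith)
    obtain ⟨y, hy1, hy2⟩ := exists_between hφ
    have hy : y ∈ S := ⟨hle0.trans hy1.le, hy2.le.trans (phiFn_lt_one G x).le,
      lowerTail_step G hβ hx.2.2 hy2 (hle0.trans hy1.le)⟩
    exact absurd (le_csSup hbdd hy) (by linarith)
  obtain ⟨x, hx, hxq⟩ := exists_lt_of_lt_csSup ⟨0, h1⟩ (hq.trans_le hsup)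
  exact hx.2.2.mono G hβ hq0 hxq.le

end Tails

/-! ### Uniform bound on the covariance with the edge count -/

section Uniform

lemma hasDerivAt_Phi (u : ℝ) : HasDerivAt Phi (Phi u * (1 - Phi u)) u := by
  rw [Phi_eq_sigmoid]; exact Real.hasDerivAt_sigmoid u

lemma eventually_lipschitz_Phi {u lam : ℝ} (h : Phi u * (1 - Phi u) < lam) :
    ∀ᶠ r in nhdsWithin (0 : ℝ) (Set.Ioi 0), ∀ a b, u - r ≤ a → a ≤ b → b ≤ u + r →
      Phi b - Phi a ≤ lam * (b - a) := by
  have hc : Continuous fun v => Phi v * (1 - Phi v) :=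
    continuous_Phi.mul (continuous_const.sub continuous_Phi)
  obtain ⟨ε, hε, hball⟩ := Metric.eventually_nhds_iff.mp (hc.continuousAt.eventually_lt_const h)
  filter_upwards [Ioo_mem_nhdsGT hε] with r hr a b ha hab hb
  refine (convex_Icc (u - r) (u + r)).image_sub_le_mul_sub_of_deriv_le
    continuous_Phi.continuousOn
    (fun x _ => (hasDerivAt_Phi x).differentiableAt.differentiableWithinAt)
    (fun x hx => ?_) a ⟨ha, hab.trans hb⟩ b ⟨ha.trans hab, hb⟩ hab
  rw [(hasDerivAt_Phi x).deriv]
  have hx := interior_subset hx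
  refine (hball ?_).le
  rw [Real.dist_eq, abs_lt]
  constructor <;> linarith [hx.1, hx.2, hr.2]

lemma outside_le_indic (l r t : ℝ) : outside l r t ≤ indic (r < t) + indic (t < l) := by
  unfold outside indic
  split_ifs with h1 h2 h3 h3 h2 h3 h3 <;> try norm_num
  exact absurd ⟨not_lt.mp h3, not_lt.mp h2⟩ h1

variable {s : ℕ} {V : Fin s → ℕ} (G : ∀ i, SimpleGraph (Fin (V i))) {β : Fin s → ℝ} {p : ℝ}

/-- The derivative of `Psi`. -/
noncomputable def derivPsi (β : Fin s → ℝ) (q : ℝ) : ℝ :=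
  ∑ i, 2 * β i * numEdges (G i) * ((numEdges (G i) - 1 : ℕ) * q ^ (numEdges (G i) - 1 - 1))

lemma hasDerivAt_phiFn (q : ℝ) :
    HasDerivAt (phiFn V G β) (phiFn V G β q * (1 - phiFn V G β q) * derivPsi G β q) q := by
  have h : HasDerivAt (Psi V G β) (derivPsi G β q) q :=
    HasDerivAt.fun_sum fun i _ => (hasDerivAt_pow (numEdges (G i) - 1) q).const_mul _
  exact (hasDerivAt_Phi (Psi V G β q)).comp q h

lemma derivPsi_nonneg (hβ : ∀ i, 0 < β i) {q : ℝ} (hq : 0 ≤ q) : 0 ≤ derivPsi G β q :=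
  sum_nonneg fun i _ => mul_nonneg (mul_nonneg (mul_nonneg zero_le_two (hβ i).le)
    (Nat.cast_nonneg _)) (mul_nonneg (Nat.cast_nonneg _) (pow_nonneg hq _))

lemma exists_add_mul_add_lt_one {a b : ℝ} (h : a * b < 1) :
    ∃ τ > 0, (a + τ) * (b + τ) < 1 := by
  have hc : Continuous fun τ : ℝ => (a + τ) * (b + τ) := by fun_prop
  have hev := hc.continuousAt.eventually_lt_const (show (a + 0) * (b + 0) < 1 by simpa using h)
  obtain ⟨τ, h1, h2⟩ := ((hev.filter_mono nhdsWithin_le_nhds).and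
    (self_mem_nhdsWithin (a := (0 : ℝ)) (s := Set.Ioi 0))).exists
  exact ⟨τ, h2, h1⟩

lemma eventually_expect_outside_le (hβ : ∀ i, 0 < β i) (hp : phiFn V G β p = p)
    (huniq : ∀ q, phiFn V G β q = q → q = p) {r : ℝ} (hr : 0 < r) (k : ℕ) :
    ∀ᶠ n : ℕ in atTop, ∀ e : EdgeSet n, expect (gibbs (weight β) (placed G))
      (fun x => outside (Psi V G β p - r) (Psi V G β p + r)
        (field (weight β) (placed G) e x)) ≤ 2 / (n : ℝ) ^ k := by
  have hp0 : 0 < p := hp ▸ phiFn_pos G p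
  have hcont := (continuous_Psi (β := β) G).continuousAt (x := p)
  obtain ⟨q, hq, hpq⟩ := (((hcont.eventually_lt_const
    (lt_add_of_pos_right (Psi V G β p) hr)).filter_mono nhdsWithin_le_nhds).and
    (self_mem_nhdsWithin (a := p) (s := Set.Ioi p))).exists
  obtain ⟨q', hq', hq'0, hpq'⟩ := (((hcont.eventually_const_lt
    (sub_lt_self (Psi V G β p) hr)).filter_mono nhdsWithin_le_nhds).and
    (Ioo_mem_nhdsLT hp0)).exists
  filter_upwards [upperTail_of_lt G hβ huniq hpq _ (sub_pos.mpr hq) k,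
    lowerTail_of_lt G hβ huniq hq'0.le hpq' _ (sub_pos.mpr hq') k] with n h1 h2 e
  have h1 := h1 e
  have h2 := h2 e
  rw [add_sub_cancel] at h1
  rw [sub_sub_cancel] at h2
  refine (expect_mono (gibbs_nonneg _ _) fun x => outside_le_indic _ _ _).trans ?_
  rw [expect_add]
  calc _ ≤ 1 / (n : ℝ) ^ k + 1 / (n : ℝ) ^ k := add_le_add h1 h2
    _ = 2 / (n : ℝ) ^ k := by ring

lemma exists_cov_edgeCount_edgeX_le (hβ : ∀ i, 0 < β i) (hsub : Subcritical V G β p) :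
    ∃ C : ℝ, ∀ᶠ n : ℕ in atTop, ∀ e : EdgeSet n,
      cov (gibbs (weight β) (placed G)) edgeCount (edgeX e) ≤ C := by
  obtain ⟨hp, huniq, hderiv⟩ := hsub
  have hp0 : 0 < p := hp ▸ phiFn_pos G p
  have hp1 : p < 1 := hp ▸ phiFn_lt_one G p
  rw [(hasDerivAt_phiFn G p).deriv, hp] at hderiv
  have hPhi : Phi (Psi V G β p) = p := hp
  obtain ⟨τ, hτ, hlt⟩ := exists_add_mul_add_lt_one hderiv
  set u := Psi V G β p with hu
  set lam := p * (1 - p) + τ with hlam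
  set T := derivPsi G β p + τ with hT
  have hT0 : 0 < T := add_pos_of_nonneg_of_pos (derivPsi_nonneg G hβ hp0.le) hτ
  have hlam0 : 0 < lam := add_pos (mul_pos hp0 (by linarith)) hτ
  obtain ⟨ρ, hρ, hρ1⟩ := exists_between hlt
  set D := ∑ i, numEdges (G i) with hD
  set K₀ := ∑ i, 2 * β i * numEdges (G i) with hK₀
  have hK₀0 : 0 ≤ K₀ := sum_nonneg fun i _ =>
    mul_nonneg (mul_nonneg zero_le_two (hβ i).le) (Nat.cast_nonneg _)
  obtain ⟨r, hlip, hrT, hr0⟩ : ∃ r, (∀ a b, u - r ≤ a → a ≤ b → b ≤ u + r →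
      Phi b - Phi a ≤ lam * (b - a)) ∧ derivPsi G β (Phi (u + r)) < T ∧ 0 < r := by
    have hc : Continuous fun r => derivPsi G β (Phi (u + r)) := by
      have := continuous_Phi
      unfold derivPsi
      fun_prop
    have hev := hc.continuousAt.eventually_lt_const
      (show derivPsi G β (Phi (u + 0)) < T by rw [add_zero, hPhi]; exact lt_add_of_pos_right _ hτ)
    exact ((eventually_lipschitz_Phi (u := u) (by rw [hPhi]; exact lt_add_of_pos_right _ hτ)).and
      ((hev.filter_mono nhdsWithin_le_nhds).and self_mem_nhdsWithin)).exists
  set K := K₀ + |u| + r with hK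
  have hη : Tendsto (fun n : ℕ => D * (2 * (D * K₀) / n) * D) atTop (nhds 0) := by
    have := (tendsto_const_div_atTop_nhds_zero_nat (2 * (D * K₀))).const_mul (D : ℝ)
    simpa using this.mul_const (D : ℝ)
  have hρ' : Tendsto (fun n : ℕ => T * lam * (1 + D * (2 * (D * K₀) / n) * D * lam)) atTop
      (nhds (T * lam)) := by
    simpa using ((hη.mul_const lam).const_add 1).const_mul (T * lam)
  refine ⟨2 + lam * ((T * lam * (2 + 2 * K * lam + 2 * K) + 2 * K * D) / (1 - ρ) + 2 * K), ?_⟩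
  filter_upwards [eventually_expect_outside_le G hβ hp huniq hr0 3,
    hη.eventually_le_const zero_lt_one,
    hρ'.eventually_le_const (show T * lam < ρ by linarith [mul_comm T lam]),
    eventually_ge_atTop 10, eventually_ge_atTop (2 ^ D)] with n h1 h2 h3 hn hnD e
  have hn0 : (0 : ℝ) < n := by exact_mod_cast (by omega : 0 < n)
  refine cov_edgeCount_edgeX_le_of_contraction (gibbs_isFerromagnetic _ (weight_nonneg hβ))
    (weight_nonneg hβ) (card_placed_le G) (fun g h hgh => sum_weight_pair_le G hβ hn hgh)
    (by positivity) (by linarith) hlam0.le hlip ?_ ?_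
    (fun g => (sum_weight_le G hβ (by omega) g).trans ?_) h1 (fun g => ?_) hT0.le ?_ h2 h3 hρ1 e
  · rw [abs_le]
    constructor <;> linarith [neg_abs_le u, le_abs_self u]
  · rw [abs_le]
    constructor <;> linarith [neg_abs_le u, le_abs_self u]
  · linarith [abs_nonneg u]
  · simp only [card_placed]
    exact (sum_weight_mul_le G hβ (by omega) (c := fun i => ((numEdges (G i) - 1 : ℕ) : ℝ) *
      Phi (u + r) ^ (numEdges (G i) - 1 - 1))
      (fun i => mul_nonneg (Nat.cast_nonneg _) (pow_nonneg (Phi_nonneg _) _)) g).trans hrT.le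
  · rw [card_edgeSet]
    have hnD' : (2 : ℝ) ^ D ≤ n := by exact_mod_cast hnD
    have : (n : ℝ) * (n - 1) / 2 * (2 ^ D * (2 / n ^ 3)) = (n - 1) * 2 ^ D / n ^ 2 := by
      field_simp
    rw [this, div_le_one (by positivity)]
    have : (0 : ℝ) < 2 ^ D := by positivity
    nlinarith

end Uniform

/-- **(Variance of the edge count and pairwise covariances).**
If `β` is sub-critical: pairwise covariances of edge indicators are nonnegative (FKG),
the variance of the total edge count is `O(M)`, and for large `n` the covariance of
two distinct edges is `≤ C/n²` if they are vertex-disjoint and `≤ C/n` if they share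
a vertex. -/
theorem edge_covariance_bounds {s : ℕ} (V : Fin s → ℕ)
    (G : ∀ i, SimpleGraph (Fin (V i))) (β : Fin s → ℝ) (hβ : ∀ i, 0 < β i)
    (p : ℝ) (hsub : Subcritical V G β p) :
    (∀ n : ℕ, ∀ i j : EdgeSet n, i ≠ j →
      0 ≤ cov (ergmProb V G β) (edgeX i) (edgeX j)) ∧
    ∃ C : ℝ, 0 < C ∧ ∃ N : ℕ, ∀ n : ℕ, N ≤ n →
      (variance (ergmProb V G β) (fun x => ∑ e : EdgeSet n, edgeX e x) ≤
        C * (Fintype.card (EdgeSet n) : ℝ)) ∧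
      (∀ i j : EdgeSet n, ¬ ShareVertex i j →
        cov (ergmProb V G β) (edgeX i) (edgeX j) ≤ C / (n : ℝ) ^ 2) ∧
      (∀ i j : EdgeSet n, i ≠ j → ShareVertex i j →
        cov (ergmProb V G β) (edgeX i) (edgeX j) ≤ C / (n : ℝ)) := by
  have hcov (n : ℕ) (i j : EdgeSet n) : 0 ≤ cov (ergmProb V G β) (edgeX i) (edgeX j) := by
    rw [ergmProb_eq_gibbs]
    exact gibbs_cov_nonneg _ (weight_nonneg hβ) (edgeX_mono i) (edgeX_mono j)
  refine ⟨fun n i j _ => hcov n i j, ?_⟩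
  obtain ⟨C, hC⟩ := exists_cov_edgeCount_edgeX_le G hβ hsub
  obtain ⟨N, hN⟩ := eventually_atTop.mp hC
  refine ⟨4 * max C 1, by positivity, max N 10, fun n hn => ?_⟩
  have hn10 : 10 ≤ n := (le_max_right _ _).trans hn
  have hn0 : (0 : ℝ) < n := by exact_mod_cast (by omega : 0 < n)
  have hbound : ∀ e : EdgeSet n, cov (ergmProb V G β) edgeCount (edgeX e) ≤ max C 1 := fun e => by
    rw [ergmProb_eq_gibbs]
    exact (hN n ((le_max_left _ _).trans hn) e).trans (le_max_left _ _)
  have hpos : 0 < max C 1 := lt_max_of_lt_right one_pos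
  have hsum_one : ∑ x, ergmProb (n := n) V G β x = 1 := by
    rw [ergmProb_eq_gibbs]
    exact gibbs_sum _ _
  have hrow : ∀ e : EdgeSet n,
      ∑ g, cov (ergmProb V G β) (edgeX e) (edgeX g) ≤ max C 1 := fun e => by
    rw [← cov_sum hsum_one, cov_comm]
    exact hbound e
  have hsym : IsSymmetricKernel fun e g : EdgeSet n =>
      cov (ergmProb V G β) (edgeX e) (edgeX g) := by
    rw [ergmProb_eq_gibbs]
    exact cov_isSymmetricKernel G
  refine ⟨?_, fun i j hs => hsym.le_of_not_share (hcov n) hrow hn10 hs, fun i j hij hs =>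
    (hsym.le_of_share (hcov n) hrow (by omega) hij hs).trans ?_⟩
  · calc variance (ergmProb V G β) (fun x => ∑ e : EdgeSet n, edgeX e x)
        = cov (ergmProb V G β) edgeCount (fun x => ∑ e : EdgeSet n, edgeX e x) := by
          simp only [variance, cov, sq]
          rfl
      _ = ∑ e : EdgeSet n, cov (ergmProb V G β) edgeCount (edgeX e) := cov_sum hsum_one _ _ _
      _ ≤ ∑ _e : EdgeSet n, max C 1 := sum_le_sum fun e _ => hbound e
      _ ≤ 4 * max C 1 * (Fintype.card (EdgeSet n) : ℝ) := by
          rw [sum_const, nsmul_eq_mul, card_univ, mul_comm]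
          exact mul_le_mul_of_nonneg_right (by linarith) (Nat.cast_nonneg _)
  · gcongr
    norm_num

end ERGM
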